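/- arXiv:2604.02086 — 2 statements merged into one kernel-verified Lean document; each statement's English description precedes it below -/
import Mathlib

section
/- Let G be a 3-connected graph on n vertices such that |N(u) ∪ N(v)| ≥ s for every pair of non-adjacent vertices u, v. Then the circumference of G is at least min{n, 3s/2}. -/
open SimpleGraph

/-- `G` contains `H` as a (not necessarily induced) subgraph. -/
def Contains {V W : Type*} (G : SimpleGraph V) (H : SimpleGraph W) : Prop :=
  ∃ f : H →g G, Function.Injective f

/-- `G` has a cycle with `m` vertices (equivalently, of length `m`). -/
def HasCycleLength {V : Type*} (G : SimpleGraph V) (m : ℕ) : Prop :=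
  ∃ (v : V) (c : G.Walk v v), c.IsCycle ∧ c.length = m

/-- The Ramsey property for `K_{a,b}` versus the cycle `C_m`: every graph `Γ` on `N` vertices
contains `K_{a,b}`, or its complement contains a cycle of length `m`. -/
def RamseyProp (a b m N : ℕ) : Prop :=
  ∀ Γ : SimpleGraph (Fin N),
    Contains Γ (completeBipartiteGraph (Fin a) (Fin b)) ∨ HasCycleLength Γᶜ m

/-- `G` is `k`-connected. -/
def IsKConnected {V : Type*} [Fintype V] (k : ℕ) (G : SimpleGraph V) : Prop :=
  k < Fintype.card V ∧
    ∀ S : Finset V, S.card < k → (G.induce ((↑S : Set V)ᶜ)).Connected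

/-- The circumference of `G`: the length of a longest cycle. -/
noncomputable def circumference {V : Type*} (G : SimpleGraph V) : ℕ :=
  sSup {m | HasCycleLength G m}

section PathLists

variable {V : Type*} {G : SimpleGraph V}

/-- The list `l` is a walk of `G` from `u` to `v`. -/
def LWalk (G : SimpleGraph V) (l : List V) (u v : V) : Prop :=
  l.IsChain G.Adj ∧ l.head? = some u ∧ l.getLast? = some v

/-- There is a path from `x` to `y` with vertices in `F` and at least `m` vertices. -/
def LongPath (G : SimpleGraph V) (F : Finset V) (x y : V) (m : ℕ) : Prop :=
  ∃ l : List V, LWalk G l x y ∧ l.Nodup ∧ (∀ v ∈ l, v ∈ F) ∧ m ≤ l.length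

lemma LWalk.single (u : V) : LWalk G [u] u u := by
  simp [LWalk]

lemma LWalk.append {l₁ l₂ : List V} {u v w z : V} (h₁ : LWalk G l₁ u v) (h₂ : LWalk G l₂ w z)
    (h : G.Adj v w) : LWalk G (l₁ ++ l₂) u z := by
  obtain ⟨c₁, a₁, b₁⟩ := h₁
  obtain ⟨c₂, a₂, b₂⟩ := h₂
  refine ⟨?_, by simp [a₁], by simp [b₂]⟩
  rw [List.isChain_append]
  refine ⟨c₁, c₂, ?_⟩
  intro x hx y hy
  simp_all

lemma LWalk.reverse {l : List V} {u v : V} (h : LWalk G l u v) : LWalk G l.reverse v u := by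
  obtain ⟨c, a, b⟩ := h
  refine ⟨?_, by simpa using b, by simpa using a⟩
  rw [List.isChain_reverse]
  exact c.imp fun _ _ h => h.symm

lemma LWalk.cons {l : List V} {u v w : V} (h : LWalk G l v w) (hu : G.Adj u v) :
    LWalk G (u :: l) u w :=
  (LWalk.single u).append h hu

lemma LWalk.ne_nil {l : List V} {u v : V} (h : LWalk G l u v) : l ≠ [] := by
  rintro rfl
  simp [LWalk] at h

lemma LWalk.head_mem {l : List V} {u v : V} (h : LWalk G l u v) : u ∈ l :=
  List.mem_of_mem_head? h.2.1

lemma LWalk.last_mem {l : List V} {u v : V} (h : LWalk G l u v) : v ∈ l :=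
  List.mem_of_mem_getLast? h.2.2

lemma LWalk.exists_cons {l : List V} {u v : V} (h : LWalk G l u v) : ∃ t, l = u :: t := by
  cases l with
  | nil => exact absurd rfl h.ne_nil
  | cons a t => exact ⟨t, by have := h.2.1; simp_all⟩

lemma LWalk.of_append_left {l₁ l₂ : List V} {u v : V} (h : LWalk G (l₁ ++ l₂) u v)
    (h₁ : l₁ ≠ []) : ∃ w, LWalk G l₁ u w := by
  refine ⟨l₁.getLast h₁, (List.isChain_append.1 h.1).1, ?_, List.getLast?_eq_some_getLast h₁⟩
  have := h.2.1
  cases l₁ <;> simp_all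

lemma LWalk.of_append_right {l₁ l₂ : List V} {u v : V} (h : LWalk G (l₁ ++ l₂) u v)
    (h₂ : l₂ ≠ []) : ∃ w, LWalk G l₂ w v := by
  refine ⟨l₂.head h₂, (List.isChain_append.1 h.1).2.1, List.head?_eq_some_head h₂, ?_⟩
  have := h.2.2
  rw [List.getLast?_append_of_ne_nil _ h₂] at this
  exact this

/-- Splitting a walk between two consecutive vertices. -/
lemma LWalk.split {X Y : List V} {u z v w : V} (h : LWalk G (X ++ v :: w :: Y) u z) :
    LWalk G (X ++ [v]) u v ∧ LWalk G (w :: Y) w z := by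
  have e : X ++ v :: w :: Y = (X ++ [v]) ++ (w :: Y) := by simp
  rw [e] at h
  obtain ⟨a, ha⟩ := h.of_append_left (by simp)
  obtain ⟨b, hb⟩ := h.of_append_right (by simp)
  have h1 := ha.2.2
  have h2 := hb.2.1
  simp at h1 h2
  subst h1 h2
  exact ⟨ha, hb⟩

lemma LWalk.splitAt {X Y : List V} {u z v : V} (h : LWalk G (X ++ v :: Y) u z) :
    LWalk G (X ++ [v]) u v ∧ LWalk G (v :: Y) v z := by
  constructor
  · have e : X ++ v :: Y = (X ++ [v]) ++ Y := by simp
    rw [e] at h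
    obtain ⟨a, ha⟩ := h.of_append_left (by simp)
    have h1 := ha.2.2
    simp at h1
    subst h1
    exact ha
  · obtain ⟨b, hb⟩ := h.of_append_right (by simp)
    have h2 := hb.2.1
    simp at h2
    subst h2
    exact hb

lemma LongPath.single {F : Finset V} {x : V} (hx : x ∈ F) : LongPath G F x x 1 :=
  ⟨[x], LWalk.single x, by simp, by simpa using hx, by simp⟩

lemma LongPath.mono {F F' : Finset V} {x y : V} {m m' : ℕ} (h : LongPath G F x y m)
    (hF : F ⊆ F') (hm : m' ≤ m) : LongPath G F' x y m' := by
  obtain ⟨l, h1, h2, h3, h4⟩ := h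
  exact ⟨l, h1, h2, fun v hv => hF (h3 v hv), hm.trans h4⟩

lemma LongPath.symm {F : Finset V} {x y : V} {m : ℕ} (h : LongPath G F x y m) :
    LongPath G F y x m := by
  obtain ⟨l, h1, h2, h3, h4⟩ := h
  exact ⟨l.reverse, h1.reverse, by simpa using h2, by simpa using h3, by simpa using h4⟩

lemma LongPath.left_mem {F : Finset V} {x y : V} {m : ℕ} (h : LongPath G F x y m) : x ∈ F := by
  obtain ⟨l, h1, h2, h3, h4⟩ := h
  exact h3 _ h1.head_mem

lemma LongPath.append [DecidableEq V] {F₁ F₂ F : Finset V} {x y z w : V} {m₁ m₂ m : ℕ}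
    (h₁ : LongPath G F₁ x y m₁) (h₂ : LongPath G F₂ z w m₂) (h : G.Adj y z)
    (hd : Disjoint F₁ F₂) (hF : F₁ ∪ F₂ ⊆ F) (hm : m ≤ m₁ + m₂) : LongPath G F x w m := by
  obtain ⟨l, h1, h2, h3, h4⟩ := h₁
  obtain ⟨l', h1', h2', h3', h4'⟩ := h₂
  refine ⟨l ++ l', h1.append h1' h, ?_, ?_, ?_⟩
  · rw [List.nodup_append']
    refine ⟨h2, h2', ?_⟩
    intro a ha ha'
    exact Finset.disjoint_left.1 hd (h3 a ha) (h3' a ha')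
  · intro v hv
    rcases List.mem_append.1 hv with hv | hv
    · exact hF (Finset.mem_union_left _ (h3 v hv))
    · exact hF (Finset.mem_union_right _ (h3' v hv))
  · rw [List.length_append]
    omega

lemma LongPath.cons [DecidableEq V] {F F' : Finset V} {u x y : V} {m m' : ℕ}
    (h : LongPath G F x y m) (hu : G.Adj u x) (hF : u ∉ F) (hF' : insert u F ⊆ F')
    (hm : m' ≤ m + 1) : LongPath G F' u y m' := by
  refine (LongPath.single (G := G) (Finset.mem_singleton_self u)).append h hu ?_ hF' (by omega)
  simpa using hF

/-- Gluing two paths that meet only in their common end. -/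
lemma LongPath.glue [DecidableEq V] {F₁ F₂ F : Finset V} {x c y : V} {m₁ m₂ m : ℕ}
    (h₁ : LongPath G F₁ x c m₁) (h₂ : LongPath G F₂ c y m₂)
    (hd : F₁ ∩ F₂ ⊆ {c}) (hF : F₁ ∪ F₂ ⊆ F) (hm : m + 1 ≤ m₁ + m₂) : LongPath G F x y m := by
  obtain ⟨l, h1, h2, h3, h4⟩ := h₁
  obtain ⟨l', h1', h2', h3', h4'⟩ := h₂
  obtain ⟨t, rfl⟩ := h1'.exists_cons
  have hmem : ∀ v ∈ l ++ t, v ∈ F := by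
    intro v hv
    rcases List.mem_append.1 hv with hv | hv
    · exact hF (Finset.mem_union_left _ (h3 v hv))
    · exact hF (Finset.mem_union_right _ (h3' v (List.mem_cons_of_mem _ hv)))
  refine ⟨l ++ t, ?_, ?_, hmem, ?_⟩
  · cases t with
    | nil =>
      have := h1'.2.2
      simp at this
      subst this
      simpa using h1
    | cons d t =>
      have := (LWalk.split (X := []) h1').2
      exact h1.append this (by have := h1'.1; simp at this; exact this.1)
  · rw [List.nodup_append']
    rw [List.nodup_cons] at h2'
    refine ⟨h2, h2'.2, ?_⟩
    intro a ha ha'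
    have : a ∈ ({c} : Finset V) :=
      hd (Finset.mem_inter.2 ⟨h3 a ha, h3' a (List.mem_cons_of_mem _ ha')⟩)
    rw [Finset.mem_singleton] at this
    subst this
    exact h2'.1 ha'
  · simp at h4' ⊢
    omega

/-- Reachability inside `F` extends along edges. -/
lemma LongPath.extend {F : Finset V} {x y z : V} (h : LongPath G F x y 1)
    (hyz : G.Adj y z) (hz : z ∈ F) : LongPath G F x z 1 := by
  obtain ⟨l, h1, h2, h3, h4⟩ := h
  by_cases hzl : z ∈ l
  · obtain ⟨X, Y, rfl⟩ := List.append_of_mem hzl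
    refine ⟨X ++ [z], h1.splitAt.1, ?_, ?_, by simp⟩
    · refine h2.sublist ?_
      simp
    · intro v hv
      apply h3
      simp at hv ⊢
      tauto
  · refine ⟨l ++ [z], h1.append (LWalk.single z) hyz, ?_, ?_, by simp⟩
    · rw [List.nodup_append']
      simp [h2, hzl]
    · intro v hv
      simp at hv
      rcases hv with hv | rfl
      · exact h3 v hv
      · exact hz

/-- The vertices of `F` outside `X` with a neighbour in `X`. -/
noncomputable def bd (G : SimpleGraph V) (F X : Finset V) : Finset V :=
  open Classical in (F \ X).filter (fun v => ∃ u ∈ X, G.Adj u v)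

lemma mem_bd {F X : Finset V} {v : V} :
    v ∈ bd G F X ↔ v ∈ F ∧ v ∉ X ∧ ∃ u ∈ X, G.Adj u v := by
  classical
  simp [bd, and_assoc]

/-- If `F` has no nonempty proper subset with empty boundary, then it is path connected. -/
lemma longPath_of_bd {F : Finset V} {x y : V} (hx : x ∈ F)
    (h : ∀ X ⊆ F, x ∈ X → y ∉ X → (bd G F X).Nonempty) : LongPath G F x y 1 := by
  classical
  by_contra hc
  obtain ⟨z, hz⟩ := h (F.filter fun z => LongPath G F x z 1) (Finset.filter_subset _ _)
    (by simp [hx, LongPath.single hx]) (by simp [hc])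
  rw [mem_bd] at hz
  obtain ⟨h1, h2, u, hu, huz⟩ := hz
  rw [Finset.mem_filter] at h2 hu
  exact h2 ⟨h1, hu.2.extend huz h1⟩

end PathLists

section ExceptionalVertex

variable {V : Type*} {G : SimpleGraph V}

/-- The number of neighbours of `w` in `F`. -/
noncomputable def degIn (G : SimpleGraph V) (F : Finset V) (w : V) : ℕ :=
  open Classical in (F.filter (G.Adj w)).card

lemma degIn_le {F S : Finset V} {w : V} (h : ∀ v ∈ F, G.Adj w v → v ∈ S) :
    degIn G F w ≤ S.card := by
  classical
  refine Finset.card_le_card fun v hv => ?_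
  rw [Finset.mem_filter] at hv
  exact h v hv.1 hv.2

lemma exists_minimal_finset {P : Finset V → Prop} (X : Finset V) (hX : P X) :
    ∃ L ⊆ X, P L ∧ ∀ Y ⊆ L, Y ≠ L → ¬ P Y := by
  induction X using Finset.strongInduction with
  | H X ih =>
    by_cases h : ∃ Y, Y ⊂ X ∧ P Y
    · obtain ⟨Y, hY, hP⟩ := h
      obtain ⟨L, h1, h2⟩ := ih Y hY hP
      exact ⟨L, h1.trans hY.1, h2⟩
    · push Not at h
      exact ⟨X, subset_rfl, hX, fun Y h1 h2 => h Y (Finset.ssubset_iff_subset_ne.2 ⟨h1, h2⟩)⟩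

lemma bd_card_le_of_subset {F X S : Finset V} (h : ∀ v ∈ F, v ∉ X → ∀ u ∈ X, G.Adj u v → v ∈ S) :
    (bd G F X).card ≤ S.card := by
  refine Finset.card_le_card fun v hv => ?_
  rw [mem_bd] at hv
  obtain ⟨h1, h2, u, hu, huv⟩ := hv
  exact h v h1 h2 u hu huv

variable [DecidableEq V]

lemma degIn_le_add_one {F F' : Finset V} {w x : V}
    (h : ∀ v ∈ F, G.Adj w v → v ≠ x → v ∈ F') : degIn G F w ≤ degIn G F' w + 1 := by
  classical
  refine le_trans (Finset.card_le_card (t := insert x (F'.filter (G.Adj w))) fun v hv => ?_)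
    (Finset.card_insert_le _ _)
  rw [Finset.mem_filter] at hv
  by_cases hvx : v = x
  · simp [hvx]
  · simp [h v hv.1 hv.2 hvx, hv.2]

/-- In a rooted 2-connected piece, a set with one boundary vertex after removing the root `x`
extends a path to the other root. -/
lemma longPath_of_single_boundary {F L : Finset V} {x y c u : V} {m : ℕ}
    (hx : x ∈ F)
    (hbd : ∀ X ⊆ F, x ∉ X → y ∉ X → X.Nonempty → 2 ≤ (bd G F X).card)
    (hL : L ⊆ F) (hxL : x ∉ L) (hyL : y ∉ L) (hc : bd G (F.erase x) L = {c})
    (hux : G.Adj u x) (h : LongPath G (insert c L) u c m) :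
    LongPath G F x y (m + 1) := by
  have hcm : c ∈ bd G (F.erase x) L := by simp [hc]
  rw [mem_bd] at hcm
  obtain ⟨hc1, hc2, -⟩ := hcm
  have key : LongPath G ((F.erase x) \ L) c y 1 := by
    apply longPath_of_bd (by simp only [Finset.mem_sdiff]; exact ⟨hc1, hc2⟩)
    intro X hX hcX hyX
    by_contra hemp
    rw [Finset.not_nonempty_iff_eq_empty] at hemp
    have h2 := hbd (X ∪ L) ?_ ?_ ?_ ⟨c, by simp [hcX]⟩
    · have : (bd G F (X ∪ L)).card ≤ ({x} : Finset V).card := by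
        apply bd_card_le_of_subset
        intro v hv hvX w hw hwv
        rw [Finset.mem_singleton]
        by_contra hvx
        rw [Finset.mem_union, not_or] at hvX
        have hv1 : v ∈ F.erase x := by simp [hv, hvx]
        rcases Finset.mem_union.1 hw with hw | hw
        · have : v ∈ bd G (F.erase x \ L) X :=
            mem_bd.2 ⟨Finset.mem_sdiff.2 ⟨hv1, hvX.2⟩, hvX.1, w, hw, hwv⟩
          simp [hemp] at this
        · have : v ∈ bd G (F.erase x) L := mem_bd.2 ⟨hv1, hvX.2, w, hw, hwv⟩
          rw [hc, Finset.mem_singleton] at this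
          exact hvX.1 (this ▸ hcX)
      simp at this
      omega
    · intro v hv
      rcases Finset.mem_union.1 hv with hv | hv
      · have := hX hv
        simp at this
        exact this.1.2
      · exact hL hv
    · intro hv
      rcases Finset.mem_union.1 hv with hv | hv
      · have := hX hv
        simp at this
      · exact hxL hv
    · intro hv
      rcases Finset.mem_union.1 hv with hv | hv
      · exact hyX hv
      · exact hyL hv
  have h2 : LongPath G (F.erase x) u y m := by
    refine h.glue key ?_ ?_ (by omega)
    · intro v hv
      simp at hv ⊢
      tauto
    · intro v hv
      simp at hv hc1 ⊢
      rcases hv with rfl | hv | hv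
      · exact hc1
      · exact ⟨fun h => hxL (h ▸ hv), hL hv⟩
      · exact hv
  refine h2.cons hux.symm (by simp) ?_ le_rfl
  intro v hv
  simp at hv
  rcases hv with rfl | hv
  · exact hx
  · exact hv.2

/-- A version of the Erdős–Gallai theorem for long paths between two roots, allowing an exceptional
vertex of small degree. -/
theorem longPath_of_degrees (n : ℕ) : ∀ (F : Finset V) (x y e : V) (k : ℕ), F.card ≤ n →
    x ∈ F → y ∈ F → x ≠ y →
    (∀ X ⊆ F, x ∉ X → y ∉ X → X.Nonempty → 2 ≤ (bd G F X).card) →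
    (∀ w ∈ F, w ≠ x → w ≠ y → w ≠ e → k ≤ degIn G F w) →
    (∃ w ∈ F, w ≠ x ∧ w ≠ y ∧ w ≠ e) → LongPath G F x y (k + 1) := by
  induction n with
  | zero =>
    intro F x y e k hF hx
    simp at hF
    simp [hF] at hx
  | succ n ih =>
    intro F x y e k hF hx hy hxy hbd hdeg hne
    obtain ⟨w₀, hw₀, hw₀x, hw₀y, hw₀e⟩ := hne
    let valid : Finset V → Prop := fun L =>
      L ⊆ F ∧ x ∉ L ∧ y ∉ L ∧ L.Nonempty ∧ (bd G (F.erase x) L).card ≤ 1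
    obtain ⟨L, hL, hmin, hcase⟩ : ∃ L, valid L ∧ (∀ Y ⊆ L, Y ≠ L → ¬ valid Y) ∧
        (e ∉ L ∨ ∀ Y, valid Y → e ∈ Y) := by
      by_cases hex : ∃ L, valid L ∧ e ∉ L
      · obtain ⟨X, hX⟩ := hex
        obtain ⟨L, -, hL, hm⟩ := exists_minimal_finset (P := fun L => valid L ∧ e ∉ L) X hX
        exact ⟨L, hL.1, fun Y hY hne hv => hm Y hY hne ⟨hv, fun h => hL.2 (hY h)⟩, Or.inl hL.2⟩
      · push Not at hex
        have hX : valid ((F.erase x).erase y) := by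
          refine ⟨?_, by simp, by simp, ⟨w₀, by simp [*]⟩, ?_⟩
          · intro v hv
            simp at hv
            exact hv.2.2
          · refine (bd_card_le_of_subset (S := {y}) ?_).trans (by simp)
            intro v hv hvX
            by_contra hvy
            simp at hv hvX hvy
            tauto
        obtain ⟨L, -, hL, hm⟩ := exists_minimal_finset (P := valid) _ hX
        exact ⟨L, hL, hm, Or.inr hex⟩
    obtain ⟨hLF, hxL, hyL, hLne, hLbd⟩ := hL
    have h2 := hbd L hLF hxL hyL hLne
    have hsub : bd G F L ⊆ insert x (bd G (F.erase x) L) := by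
      intro v hv
      rw [mem_bd] at hv
      by_cases hvx : v = x
      · simp [hvx]
      · refine Finset.mem_insert_of_mem (mem_bd.2 ⟨?_, hv.2⟩)
        simp [hvx, hv.1]
    obtain ⟨c, hc⟩ : ∃ c, bd G (F.erase x) L = {c} := by
      apply Finset.card_eq_one.1
      have := (Finset.card_le_card hsub).trans (Finset.card_insert_le _ _)
      omega
    obtain ⟨u, hu, hux⟩ : ∃ u ∈ L, G.Adj u x := by
      by_contra hno
      have : bd G F L ⊆ bd G (F.erase x) L := by
        intro v hv
        have h1 := mem_bd.1 hv
        rcases Finset.mem_insert.1 (hsub hv) with rfl | h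
        · exact absurd h1.2.2 hno
        · exact h
      have := Finset.card_le_card this
      omega
    have hcm : c ∈ bd G (F.erase x) L := by simp [hc]
    rw [mem_bd] at hcm
    obtain ⟨hc1, hc2, z, hz, hzc⟩ := hcm
    rw [Finset.mem_erase] at hc1
    have hLnb : ∀ w ∈ L, ∀ v ∈ F, G.Adj w v → v ≠ x → v ∈ insert c L := by
      intro w hw v hv hwv hvx
      by_cases hvL : v ∈ L
      · simp [hvL]
      · have : v ∈ bd G (F.erase x) L := mem_bd.2 ⟨by simp [hv, hvx], hvL, w, hw, hwv⟩
        rw [hc] at this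
        simp_all
    have finish : ∀ m, k ≤ m → LongPath G (insert c L) u c m → LongPath G F x y (k + 1) :=
      fun m hm h => (longPath_of_single_boundary hx hbd hLF hxL hyL hc hux h).mono
        subset_rfl (by omega)
    have huc : u ≠ c := fun h => hc2 (h ▸ hu)
    have hcF : insert c L ⊆ F := by
      intro v hv
      rcases Finset.mem_insert.1 hv with rfl | hv
      · exact hc1.2
      · exact hLF hv
    by_cases hw : ∃ w ∈ L, w ≠ u ∧ w ≠ e
    · obtain ⟨w, hwL, hwu, hwe⟩ := hw
      have hcard : (insert c L).card ≤ n := by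
        have : (insert c L) ⊂ F := by
          rw [Finset.ssubset_iff_of_subset hcF]
          exact ⟨x, hx, by simp [hxL, Ne.symm hc1.1]⟩
        have := Finset.card_lt_card this
        omega
      refine finish _ (by omega) (ih (insert c L) u c e (k - 1) hcard (by simp [hu]) (by simp)
        huc ?_ ?_ ⟨w, by simp [hwL], hwu, fun h => hc2 (h ▸ hwL), hwe⟩)
      · intro X hX huX hcX hXne
        have hXL : X ⊆ L := by
          intro v hv
          rcases Finset.mem_insert.1 (hX hv) with rfl | h
          · exact absurd hv hcX
          · exact h
        have := hmin X hXL (fun h => huX (h ▸ hu))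
        have h3 : 2 ≤ (bd G (F.erase x) X).card := by
          by_contra hlt
          exact this ⟨hXL.trans hLF, fun h => hxL (hXL h), fun h => hyL (hXL h), hXne, by omega⟩
        refine h3.trans (Finset.card_le_card ?_)
        intro v hv
        rw [mem_bd] at hv ⊢
        obtain ⟨h1, h2, w, hw, hwv⟩ := hv
        simp only [Finset.mem_erase] at h1
        exact ⟨hLnb w (hXL hw) v h1.2 hwv h1.1, h2, w, hw, hwv⟩
      · intro w hw hwu hwc hwe
        have hwL : w ∈ L := by simpa [hwc] using hw
        have h1 := hdeg w (hLF hwL) (fun h => hxL (h ▸ hwL)) (fun h => hyL (h ▸ hwL)) hwe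
        have h2 : degIn G F w ≤ degIn G (insert c L) w + 1 := degIn_le_add_one (hLnb w hwL)
        omega
    push Not at hw
    by_cases hue : u = e
    · subst hue
      have hLe : L = {u} := by
        ext v
        rw [Finset.mem_singleton]
        refine ⟨fun hv => ?_, fun h => h ▸ hu⟩
        by_contra h
        exact h (hw v hv h)
      have hall := hcase.resolve_left (by simp [hu])
      clear hcase
      subst hLe
      simp only [Finset.mem_singleton] at hxL hyL hc2 hz
      subst hz
      have hzn : ∀ v ∈ F, G.Adj z v → v ≠ x → v = c := by
        intro v hv hzv hvx
        have := hLnb z (by simp) v hv hzv hvx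
        rcases Finset.mem_insert.1 this with h | h
        · exact h
        · rw [Finset.mem_singleton] at h
          exact absurd h hzv.ne'
      have hcy : c ≠ y := by
        rintro rfl
        have := hall (((F.erase x).erase c).erase z) ⟨?_, by simp, by simp,
          ⟨w₀, by simp [*]⟩, ?_⟩
        · simp at this
        · intro v hv
          simp at hv
          tauto
        · refine (bd_card_le_of_subset (S := {c}) ?_).trans (by simp)
          intro v hv hvX w hw hwv
          simp at hv hvX hw
          rw [Finset.mem_singleton]
          by_contra hvc
          have hvz : v = z := by
            by_contra hvz
            exact hvX hvz hvc hv.1 hv.2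
          subst hvz
          exact hw.2.1 (hzn w hw.2.2.2 hwv.symm hw.2.2.1)
      by_cases hw' : ∃ w ∈ F, w ≠ x ∧ w ≠ y ∧ w ≠ z ∧ w ≠ c
      · obtain ⟨w, hwF, hwx, hwy, hwz, hwc⟩ := hw'
        have hP : LongPath G ((F.erase x).erase z) c y (k - 1 + 1) := by
          refine ih _ c y c (k - 1) ?_ (by simp [hc1, hc2]) ?_ hcy ?_ ?_ ⟨w, ?_⟩
          · refine (Finset.card_le_card (Finset.erase_subset _ _)).trans ?_
            rw [Finset.card_erase_of_mem hx]
            omega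
          · simp [hy, Ne.symm hxy, hyL]
          · intro X hX hcX hyX hXne
            have hXF : X ⊆ F := hX.trans ((Finset.erase_subset _ _).trans (Finset.erase_subset _ _))
            have hzX : z ∉ X := fun h => by simpa using hX h
            have hxX : x ∉ X := fun h => by simpa using hX h
            have h3 : 2 ≤ (bd G (F.erase x) X).card := by
              by_contra hlt
              exact hzX (hall X ⟨hXF, hxX, hyX, hXne, by omega⟩)
            refine h3.trans (Finset.card_le_card ?_)
            intro v hv
            rw [mem_bd] at hv ⊢
            obtain ⟨h1, h2, t, ht, htv⟩ := hv
            refine ⟨Finset.mem_erase.2 ⟨?_, h1⟩, h2, t, ht, htv⟩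
            rintro rfl
            exact hcX (hzn t (hXF ht) htv.symm (fun h => hxX (h ▸ ht)) ▸ ht)
          · intro w hw hwc hwy _
            simp at hw
            have h1 := hdeg w hw.2.2 hw.2.1 hwy hw.1
            have h2 : degIn G F w ≤ degIn G ((F.erase x).erase z) w + 1 := by
              apply degIn_le_add_one (x := x)
              intro v hv hwv hvx
              simp only [Finset.mem_erase]
              refine ⟨?_, hvx, hv⟩
              rintro rfl
              exact hwc (hzn w hw.2.2 hwv.symm hw.2.1)
            omega
          · simp [hwF, hwx, hwy, hwz, hwc]
        have hP2 : LongPath G (F.erase x) z y (k + 1) := by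
          refine hP.cons hzc (by simp) ?_ (by omega)
          intro v hv
          simp at hv ⊢
          rcases hv with rfl | hv
          · exact ⟨Ne.symm hxL, hLF (by simp)⟩
          · exact hv.2
        refine hP2.cons hux.symm (by simp) ?_ (by omega)
        intro v hv
        simp at hv
        rcases hv with rfl | hv
        · exact hx
        · exact hv.2
      · push Not at hw'
        have hk : k ≤ 3 := by
          refine (hdeg c hc1.2 hc1.1 hcy hc2).trans
            ((degIn_le (S := {x, y, z}) ?_).trans Finset.card_le_three)
          intro v hv hcv
          simp
          by_contra hn
          push Not at hn
          exact hcv.ne' (hw' v hv hn.1 hn.2.1 hn.2.2)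
        have hcy' : G.Adj c y := by
          have h3 := hbd {c, z} ?_ ?_ ?_ (by simp)
          · by_contra hno
            have : (bd G F {c, z}).card ≤ ({x} : Finset V).card := by
              apply bd_card_le_of_subset
              intro v hv hvX w hw hwv
              simp at hvX hw ⊢
              by_contra hvx
              have hvy : v = y := by
                by_contra hvy
                exact hvX.1 (hw' v hv hvx hvy hvX.2)
              subst hvy
              rcases hw with rfl | rfl
              · exact hno hwv
              · exact hvX.1 (hzn v hv hwv hvx)
            simp at this
            omega
          · intro v hv
            simp at hv
            rcases hv with rfl | rfl
            · exact hc1.2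
            · exact hLF (by simp)
          · simp
            exact ⟨Ne.symm hc1.1, hxL⟩
          · simp
            exact ⟨Ne.symm hcy, hyL⟩
        have p1 : LongPath G {c, y} c y 2 :=
          (LongPath.single (Finset.mem_singleton_self y)).cons hcy' (by simpa using hcy)
            subset_rfl (by omega)
        have p2 : LongPath G {z, c, y} z y 3 :=
          p1.cons hzc (by simp [Ne.symm hc2, Ne.symm hyL]) subset_rfl (by omega)
        refine p2.cons hux.symm (by simp [hxL, hxy, Ne.symm hc1.1]) ?_ (by omega)
        intro v hv
        simp at hv
        rcases hv with rfl | rfl | rfl | rfl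
        · exact hx
        · exact hLF (by simp)
        · exact hc1.2
        · exact hy
    · have huF := hLF hu
      have hdu := hdeg u huF (fun h => hxL (h ▸ hu)) (fun h => hyL (h ▸ hu)) hue
      by_cases heL : e ∈ L
      · have hLe : ∀ v ∈ L, v = u ∨ v = e := fun v hv => by
          by_contra h
          push Not at h
          exact h.2 (hw v hv h.1)
        have hk : k ≤ 3 := by
          refine hdu.trans ((degIn_le (S := {x, e, c}) ?_).trans Finset.card_le_three)
          intro v hv huv
          simp
          by_contra hn
          push Not at hn
          have := hLnb u hu v hv huv hn.1
          rcases Finset.mem_insert.1 this with h | h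
          · exact hn.2.2 h
          · rcases hLe v h with h | h
            · exact huv.ne' h
            · exact hn.2.1 h
        have heu : bd G (F.erase x) {e} = {u, c} := by
          apply Finset.eq_of_subset_of_card_le
          · intro v hv
            rw [mem_bd] at hv
            obtain ⟨h1, h2, w, hw, hwv⟩ := hv
            simp at h1 h2 hw
            subst hw
            have := hLnb w heL v h1.2 hwv h1.1
            rcases Finset.mem_insert.1 this with h | h
            · simp [h]
            · rcases hLe v h with h | h
              · simp [h]
              · exact absurd h h2
          · refine Finset.card_le_two.trans ?_
            by_contra hlt
            refine hmin {e} (by simpa using heL) ?_ ⟨?_, ?_, ?_, by simp, by omega⟩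
            · intro h
              rw [← h] at hu
              simp at hu
              exact hue hu
            · simpa using hLF heL
            · simp
              rintro rfl
              exact hxL heL
            · simp
              rintro rfl
              exact hyL heL
        have a1 : G.Adj e u := by
          have : u ∈ bd G (F.erase x) {e} := by simp [heu]
          simpa [mem_bd] using (mem_bd.1 this).2.2
        have a2 : G.Adj e c := by
          have : c ∈ bd G (F.erase x) {e} := by simp [heu]
          simpa [mem_bd] using (mem_bd.1 this).2.2
        refine finish 3 hk ?_
        have p1 : LongPath G {e, c} e c 2 :=
          (LongPath.single (Finset.mem_singleton_self c)).cons a2 (by simpa using a2.ne)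
            subset_rfl (by omega)
        refine p1.cons a1.symm (by simp [hue, huc]) ?_ (by omega)
        intro v hv
        simp at hv ⊢
        rcases hv with rfl | rfl | rfl <;> simp [*]
      · have hLu : ∀ v ∈ L, v = u := fun v hv => by
          by_contra h
          exact heL (hw v hv h ▸ hv)
        have hk : k ≤ 2 := by
          refine hdu.trans ((degIn_le (S := {x, c}) ?_).trans Finset.card_le_two)
          intro v hv huv
          simp
          by_contra hn
          push Not at hn
          have := hLnb u hu v hv huv hn.1
          rcases Finset.mem_insert.1 this with h | h
          · exact hn.2 h
          · exact huv.ne' (hLu v h)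
        rw [hLu z hz] at hzc
        refine finish 2 hk ((LongPath.single (Finset.mem_singleton_self c)).cons hzc
          (by simpa using huc) ?_ le_rfl)
        intro v hv
        simp at hv ⊢
        rcases hv with rfl | rfl <;> simp [*]

end ExceptionalVertex

section Components

variable {V : Type*} {G : SimpleGraph V}

/-- `G` cannot be separated by fewer than three vertices. -/
def ThreeConn (G : SimpleGraph V) : Prop :=
  ∀ X S : Finset V, S.card ≤ 2 → (∃ v ∈ X, v ∉ S) → (∃ z, z ∉ X ∧ z ∉ S) →
    ∃ v ∈ X, ∃ w, v ∉ S ∧ w ∉ X ∧ w ∉ S ∧ G.Adj v w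

/-- `H` is the vertex set of a component of `G - C`. -/
structure IsComp (G : SimpleGraph V) (C H : Finset V) : Prop where
  nonempty : H.Nonempty
  disj : Disjoint H C
  closed : ∀ v ∈ H, ∀ w, G.Adj v w → w ∉ C → w ∈ H
  conn : ∀ X ⊆ H, X.Nonempty → X ≠ H → (bd G H X).Nonempty

/-- A path inside `H` with at least `m` vertices whose ends are attached to `x` and `y`. -/
def Link (G : SimpleGraph V) (H : Finset V) (x y : V) (m : ℕ) : Prop :=
  ∃ u w, G.Adj x u ∧ G.Adj w y ∧ LongPath G H u w m

/-- Three vertices of `C` pairwise joined through `H` by paths with at least `m` inner vertices. -/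
def Triple (G : SimpleGraph V) (C H : Finset V) (m : ℕ) : Prop :=
  ∃ x₁ ∈ C, ∃ x₂ ∈ C, ∃ x₃ ∈ C, x₁ ≠ x₂ ∧ x₁ ≠ x₃ ∧ x₂ ≠ x₃ ∧
    Link G H x₁ x₂ m ∧ Link G H x₁ x₃ m ∧ Link G H x₂ x₃ m

lemma Link.symm {H : Finset V} {x y : V} {m : ℕ} (h : Link G H x y m) : Link G H y x m := by
  obtain ⟨u, w, h1, h2, h3⟩ := h
  exact ⟨w, u, h2.symm, h1.symm, h3.symm⟩

/-- A component that is an edge whose ends have no common neighbour on `C`. -/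
def IsSpecial (G : SimpleGraph V) (C H : Finset V) : Prop :=
  ∃ u₁ u₂, u₁ ≠ u₂ ∧ (∀ v, v ∈ H ↔ v = u₁ ∨ v = u₂) ∧ G.Adj u₁ u₂ ∧
    ∀ x ∈ C, G.Adj u₁ x → ¬ G.Adj u₂ x

lemma IsComp.longPath {C H : Finset V} (hH : IsComp G C H) {u w : V} (hu : u ∈ H) (hw : w ∈ H) :
    LongPath G H u w 1 :=
  longPath_of_bd hu fun X hX hu hy => hH.conn X hX ⟨u, hu⟩ fun h => hy (h ▸ hw)

lemma LongPath.two_le {F : Finset V} {x y : V} {m : ℕ} (h : LongPath G F x y m) (hxy : x ≠ y) :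
    LongPath G F x y 2 := by
  obtain ⟨l, h1, h2, h3, h4⟩ := h
  refine ⟨l, h1, h2, h3, ?_⟩
  obtain ⟨t, rfl⟩ := h1.exists_cons
  cases t with
  | nil =>
    have := h1.2.2
    simp at this
    exact absurd this hxy
  | cons a t => simp

/-- A minimal set `K` attached to the rest of `H` at the single vertex `r`. -/
structure IsLeaf (G : SimpleGraph V) (H K : Finset V) (r : V) : Prop where
  sub : K ⊆ H
  nonempty : K.Nonempty
  bd_eq : bd G H K = {r}
  minimal : ∀ Y ⊆ K, Y.Nonempty → Y ≠ K → 2 ≤ (bd G H Y).card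

lemma IsComp.exists_isLeaf {C H : Finset V} (hH : IsComp G C H) {w : V} (hw : w ∈ H)
    (h2 : ∃ v ∈ H, v ≠ w) : ∃ K r, IsLeaf G H K r ∧ w ∉ K := by
  classical
  obtain ⟨v, hv, hvw⟩ := h2
  obtain ⟨K, hK, ⟨hKne, hKbd⟩, hmin⟩ := exists_minimal_finset
    (P := fun K => K.Nonempty ∧ (bd G H K).card ≤ 1) (H.erase w) ⟨⟨v, by simp [hv, hvw]⟩, by
      refine (bd_card_le_of_subset (S := {w}) ?_).trans (by simp)
      intro z hz hz' _ _ _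
      simp at hz' ⊢
      by_contra h
      exact hz' h hz⟩
  have hKH : K ⊆ H := hK.trans (Finset.erase_subset _ _)
  have hwK : w ∉ K := fun h => by simpa using hK h
  have hne := hH.conn K hKH hKne (fun h => hwK (h ▸ hw))
  obtain ⟨r, hr⟩ := Finset.card_eq_one.1 (le_antisymm hKbd hne.card_pos)
  refine ⟨K, r, ⟨hKH, hKne, hr, ?_⟩, hwK⟩
  intro Y hY hYne hYK
  by_contra hlt
  exact hmin Y hY hYK ⟨hYne, by omega⟩

lemma IsLeaf.root_mem {H K : Finset V} {r : V} (h : IsLeaf G H K r) : r ∈ H ∧ r ∉ K := by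
  have : r ∈ bd G H K := by simp [h.bd_eq]
  rw [mem_bd] at this
  exact ⟨this.1, this.2.1⟩

lemma IsLeaf.eq_root {H K : Finset V} {r u v : V} (h : IsLeaf G H K r) (hu : u ∈ K) (hv : v ∈ H)
    (hvK : v ∉ K) (huv : G.Adj u v) : v = r := by
  have : v ∈ bd G H K := mem_bd.2 ⟨hv, hvK, u, hu, huv⟩
  simpa [h.bd_eq] using this

variable [DecidableEq V]

lemma exists_matching_three (L R : Finset V) (E : V → V → Prop)
    (hcov : ∀ S₁ ⊆ L, ∀ S₂ ⊆ R, (∀ u ∈ L, u ∉ S₁ → ∀ x ∈ R, E u x → x ∈ S₂) →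
      3 ≤ S₁.card + S₂.card) :
    ∃ u₁ ∈ L, ∃ u₂ ∈ L, ∃ u₃ ∈ L, ∃ x₁ ∈ R, ∃ x₂ ∈ R, ∃ x₃ ∈ R, u₁ ≠ u₂ ∧ u₁ ≠ u₃ ∧ u₂ ≠ u₃ ∧
      x₁ ≠ x₂ ∧ x₁ ≠ x₃ ∧ x₂ ≠ x₃ ∧ E u₁ x₁ ∧ E u₂ x₂ ∧ E u₃ x₃ := by
  classical
  have hL : 3 ≤ L.card := by
    have := hcov L subset_rfl ∅ (by simp) (fun u hu hn => absurd hu hn)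
    simpa using this
  let D : Finset (V ⊕ ℕ) := (Finset.range (L.card - 3)).map Function.Embedding.inr
  let N : V → Finset (V ⊕ ℕ) := fun u => (R.filter (E u)).map Function.Embedding.inl
  let t : L → Finset (V ⊕ ℕ) := fun u => N u ∪ D
  have hall : ∀ s : Finset L, s.card ≤ (s.biUnion t).card := by
    intro s
    rcases s.eq_empty_or_nonempty with rfl | ⟨a, ha⟩
    · simp
    have h1 := hcov (L \ s.map (Function.Embedding.subtype _)) Finset.sdiff_subset
      ((s.map (Function.Embedding.subtype _)).biUnion fun u => R.filter (E u)) ?_ ?_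
    · have e1 : (L \ s.map (Function.Embedding.subtype _)).card = L.card - s.card := by
        rw [Finset.card_sdiff_of_subset, Finset.card_map]
        intro x hx
        simp at hx
        exact hx.1
      have e2 : s.card ≤ L.card := by
        have := Finset.card_le_univ s
        simpa using this
      have e3 : ((((s.map (Function.Embedding.subtype _)).biUnion fun u => R.filter (E u)).map
          (Function.Embedding.inl : V ↪ V ⊕ ℕ)) ∪ D) ⊆ s.biUnion t := by
        intro x hx
        rw [Finset.mem_biUnion]
        rcases Finset.mem_union.1 hx with hx | hx
        · simp only [Finset.mem_map, Finset.mem_biUnion] at hx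
          obtain ⟨y, ⟨u, ⟨u', hu', rfl⟩, hy⟩, rfl⟩ := hx
          exact ⟨u', hu', Finset.mem_union_left _ (Finset.mem_map_of_mem _ hy)⟩
        · exact ⟨a, ha, Finset.mem_union_right _ hx⟩
      have e4 := Finset.card_le_card e3
      rw [Finset.card_union_of_disjoint, Finset.card_map] at e4
      · simp only [D, Finset.card_map, Finset.card_range] at e4
        omega
      · rw [Finset.disjoint_left]
        intro x hx hx'
        simp only [D, Finset.mem_map] at hx hx'
        obtain ⟨y, -, rfl⟩ := hx
        obtain ⟨z, -, hz⟩ := hx'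
        cases hz
    · intro x hx
      obtain ⟨u, -, hu⟩ := Finset.mem_biUnion.1 hx
      exact (Finset.mem_filter.1 hu).1
    · intro u hu hus x hx hux
      rw [Finset.mem_biUnion]
      refine ⟨u, ?_, by simp [hx, hux]⟩
      by_contra hn
      exact hus (Finset.mem_sdiff.2 ⟨hu, hn⟩)
  obtain ⟨f, hf, hft⟩ := (Finset.all_card_le_biUnion_card_iff_exists_injective t).1 hall
  let M : Finset L := Finset.univ.filter fun u => f u ∉ D
  have hM : 3 ≤ M.card := by
    have h1 : (Finset.univ.filter fun u => f u ∈ D).card ≤ D.card := by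
      refine Finset.card_le_card_of_injOn f ?_ hf.injOn
      intro u hu
      simpa using hu
    have h2 := Finset.card_filter_add_card_filter_not (s := (Finset.univ : Finset L))
      (fun u => f u ∈ D)
    simp only [D, Finset.card_map, Finset.card_range, Finset.card_univ, Fintype.card_coe] at h1 h2
    simp only [M, D]
    omega
  obtain ⟨a, ha, b, hb, c, hc, hab, hac, hbc⟩ := Finset.two_lt_card.1 hM
  have key : ∀ u : L, u ∈ M → ∃ x ∈ R, E u x ∧ f u = Sum.inl x := by
    intro u hu
    have h1 := hft u
    simp only [M, Finset.mem_filter] at hu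
    rcases Finset.mem_union.1 h1 with h | h
    · simp only [N, Finset.mem_map, Finset.mem_filter] at h
      obtain ⟨x, hx, hxe⟩ := h
      exact ⟨x, hx.1, hx.2, hxe.symm⟩
    · exact absurd h hu.2
  obtain ⟨x, hx, hx1, hx2⟩ := key a ha
  obtain ⟨y, hy, hy1, hy2⟩ := key b hb
  obtain ⟨z, hz, hz1, hz2⟩ := key c hc
  refine ⟨a, a.2, b, b.2, c, c.2, x, hx, y, hy, z, hz, ?_, ?_, ?_, ?_, ?_, ?_, hx1, hy1, hz1⟩
  · exact fun h => hab (Subtype.ext h)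
  · exact fun h => hac (Subtype.ext h)
  · exact fun h => hbc (Subtype.ext h)
  · rintro rfl
    exact hab (hf (hx2.trans hy2.symm))
  · rintro rfl
    exact hac (hf (hx2.trans hz2.symm))
  · rintro rfl
    exact hbc (hf (hy2.trans hz2.symm))

lemma IsLeaf.longPath_root {C H K : Finset V} {r w : V} (h : IsLeaf G H K r) (hH : IsComp G C H)
    (hw : w ∈ H) (hwK : w ∉ K) : LongPath G (H \ K) r w 1 := by
  refine longPath_of_bd (by simp [h.root_mem]) ?_
  intro X hX hrX hwX
  by_contra hemp
  rw [Finset.not_nonempty_iff_eq_empty] at hemp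
  obtain ⟨v, hv⟩ := hH.conn (X ∪ K)
    (Finset.union_subset (hX.trans Finset.sdiff_subset) h.sub) ⟨r, by simp [hrX]⟩ (by
      intro he
      rw [← he, Finset.mem_union] at hw
      tauto)
  · rw [mem_bd] at hv
    obtain ⟨hv1, hv2, u, hu, huv⟩ := hv
    rw [Finset.mem_union, not_or] at hv2
    rcases Finset.mem_union.1 hu with hu | hu
    · have : v ∈ bd G (H \ K) X := mem_bd.2 ⟨by simp [hv1, hv2], hv2.1, u, hu, huv⟩
      simp [hemp] at this
    · exact hv2.1 (h.eq_root hu hv1 hv2.2 huv ▸ hrX)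

/-- Long paths between any two vertices of a leaf with its root. -/
lemma IsLeaf.longPath {H K : Finset V} {r p q : V} {d : ℕ} (h : IsLeaf G H K r)
    (hK : 2 ≤ K.card) (hd : ∀ v ∈ K, d ≤ degIn G H v) (hp : p ∈ insert r K)
    (hq : q ∈ insert r K) (hpq : p ≠ q) : LongPath G (insert r K) p q (d + 1) := by
  have hnb : ∀ u ∈ K, ∀ v ∈ H, G.Adj u v → v ∈ insert r K := by
    intro u hu v hv huv
    by_cases hvK : v ∈ K
    · simp [hvK]
    · simp [h.eq_root hu hv hvK huv]
  have hr := h.root_mem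
  have hFH : insert r K ⊆ H := by
    intro v hv
    rcases Finset.mem_insert.1 hv with rfl | hv
    · exact hr.1
    · exact h.sub hv
  by_cases hw : ∃ w ∈ K, w ≠ p ∧ w ≠ q
  · obtain ⟨w, hwK, hwp, hwq⟩ := hw
    refine longPath_of_degrees _ (insert r K) p q r d le_rfl hp hq hpq ?_ ?_
      ⟨w, by simp [hwK], hwp, hwq, fun h => hr.2 (h ▸ hwK)⟩
    · intro X hX hpX hqX hXne
      by_cases hrX : r ∈ X
      · by_contra hlt
        have hpK : p ∈ K := by
          rcases Finset.mem_insert.1 hp with rfl | hp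
          · exact absurd hrX hpX
          · exact hp
        have hqK : q ∈ K := by
          rcases Finset.mem_insert.1 hq with rfl | hq
          · exact absurd hrX hqX
          · exact hq
        have : Nonempty V := ⟨p⟩
        obtain ⟨z, hz⟩ := Finset.card_le_one_iff_subset_singleton.1
          (show (bd G (insert r K) X).card ≤ 1 by omega)
        let Y := (K \ X).erase z
        have hYX : ∀ u ∈ Y, ∀ v ∈ X, ¬ G.Adj u v := by
          intro u hu v hv huv
          simp only [Y, Finset.mem_erase, Finset.mem_sdiff] at hu
          have : u ∈ bd G (insert r K) X := mem_bd.2 ⟨by simp [hu], hu.2.2, v, hv, huv.symm⟩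
          have := hz this
          simp at this
          exact hu.1 this
        have hYK : Y ⊆ K := (Finset.erase_subset _ _).trans Finset.sdiff_subset
        have hYne : Y.Nonempty := by
          by_cases hpz : p = z
          · exact ⟨q, by simp [Y, hqK, hqX, ← hpz, Ne.symm hpq]⟩
          · exact ⟨p, by simp [Y, hpK, hpX, hpz]⟩
        have hYneK : Y ≠ K := by
          intro he
          have : r ∈ bd G H K := by simp [h.bd_eq]
          obtain ⟨-, -, u, hu, hur⟩ := mem_bd.1 this
          exact hYX u (he ▸ hu) r hrX hur
        have h1 := h.minimal Y hYK hYne hYneK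
        have h2 : (bd G H Y).card ≤ ({z} : Finset V).card := by
          apply bd_card_le_of_subset
          intro v hv hvY u hu huv
          rw [Finset.mem_singleton]
          by_contra hvz
          rcases Finset.mem_insert.1 (hnb u (hYK hu) v hv huv) with rfl | hvK
          · exact hYX u hu _ hrX huv
          · by_cases hvX : v ∈ X
            · exact hYX u hu v hvX huv
            · exact hvY (by simp [Y, hvz, hvK, hvX])
        simp at h2
        omega
      · have hXK : X ⊆ K := by
          intro v hv
          rcases Finset.mem_insert.1 (hX hv) with rfl | h
          · exact absurd hv hrX
          · exact h
        have hne : X ≠ K := by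
          rintro rfl
          rw [Finset.mem_insert] at hp hq
          exact hpq ((hp.resolve_right hpX).trans (hq.resolve_right hqX).symm)
        refine (h.minimal X hXK hXne hne).trans (Finset.card_le_card ?_)
        intro v hv
        rw [mem_bd] at hv ⊢
        obtain ⟨h1, h2, u, hu, huv⟩ := hv
        exact ⟨hnb u (hXK hu) v h1 huv, h2, u, hu, huv⟩
    · intro w hw hwp hwq hwr
      have hwK : w ∈ K := by simpa [hwr] using hw
      classical
      refine (hd w hwK).trans (Finset.card_le_card ?_)
      intro v hv
      rw [Finset.mem_filter] at hv ⊢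
      exact ⟨hnb w hwK v hv.1 hv.2, hv.2⟩
  · push Not at hw
    have hKe : K = {p, q} := by
      apply Finset.eq_of_subset_of_card_le
      · intro v hv
        by_cases hvp : v = p
        · simp [hvp]
        · simp [hw v hv hvp]
      · exact Finset.card_le_two.trans hK
    have hpr : ∀ p q, p ≠ q → K = {p, q} → G.Adj p r := by
      intro p q hpq hKe
      by_contra hno
      have h1 := h.minimal {p} (by simp [hKe]) (by simp) (by
        intro h
        have : q ∈ ({p} : Finset V) := by rw [h, hKe]; simp
        simp at this
        exact hpq this.symm)
      have h2 : (bd G H {p}).card ≤ ({q} : Finset V).card := by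
        apply bd_card_le_of_subset
        intro v hv hvp u hu huv
        simp at hu hvp ⊢
        subst hu
        have := hnb u (by simp [hKe]) v hv huv
        rcases Finset.mem_insert.1 this with rfl | hv
        · exact absurd huv hno
        · rw [hKe] at hv
          simpa [hvp] using hv
      simp at h2
      omega
    have hd2 : d ≤ 2 := by
      refine (hd p (by simp [hKe])).trans ((degIn_le (S := {r, q}) ?_).trans Finset.card_le_two)
      intro v hv hpv
      have := hnb p (by simp [hKe]) v hv hpv
      rw [hKe] at this
      simp at this ⊢
      have := hpv.ne
      tauto
    have a1 := hpr p q hpq hKe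
    have a2 := hpr q p hpq.symm (by rw [hKe, Finset.pair_comm])
    have p1 : LongPath G {r, q} r q 2 :=
      (LongPath.single (Finset.mem_singleton_self q)).cons a2.symm (by simpa using a2.ne')
        subset_rfl (by omega)
    refine p1.cons a1 (by simp [hpq, a1.ne]) ?_ (by omega)
    rw [hKe]
    intro v hv
    simp at hv ⊢
    tauto

end Components

section Structure

variable {V : Type*} {G : SimpleGraph V}

/-- The vertices of `C` with a neighbour in `X`. -/
noncomputable def attach (G : SimpleGraph V) (C X : Finset V) : Finset V :=
  open Classical in C.filter fun x => ∃ u ∈ X, G.Adj u x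

lemma mem_attach {C X : Finset V} {x : V} :
    x ∈ attach G C X ↔ x ∈ C ∧ ∃ u ∈ X, G.Adj u x := by
  classical
  simp [attach]

variable [DecidableEq V]

/-- A component meets the rest of a 3-connected graph in a strong sense: few vertices do not
separate it. -/
lemma IsComp.exists_exit {C H X S : Finset V} (hG : ThreeConn G) (hC : 3 ≤ C.card)
    (hH : IsComp G C H) (hXH : X ⊆ H) (hS : S.card ≤ 2) (hX : ∃ v ∈ X, v ∉ S) :
    ∃ v ∈ X, ∃ w, v ∉ S ∧ w ∉ X ∧ w ∉ S ∧ G.Adj v w ∧ (w ∈ H ∨ w ∈ C) := by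
  have hz : ∃ z, z ∉ X ∧ z ∉ S := by
    by_contra hn
    push Not at hn
    have : C ⊆ S := fun z hz => hn z fun h => Finset.disjoint_left.1 hH.disj (hXH h) hz
    have := Finset.card_le_card this
    omega
  obtain ⟨v, hv, w, h1, h2, h3, h4⟩ := hG X S hS hX hz
  refine ⟨v, hv, w, h1, h2, h3, h4, ?_⟩
  by_cases hw : w ∈ C
  · exact Or.inr hw
  · exact Or.inl (hH.closed v (hXH hv) w h4 hw)

lemma IsComp.three_le_attach {C H : Finset V} (hG : ThreeConn G) (hC : 3 ≤ C.card)
    (hH : IsComp G C H) : 3 ≤ (attach G C H).card := by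
  by_contra hlt
  have hdis : ∀ v ∈ H, v ∉ attach G C H := fun v hv h =>
    Finset.disjoint_left.1 hH.disj hv (mem_attach.1 h).1
  obtain ⟨v, hv⟩ := hH.nonempty
  obtain ⟨v, hv, w, h1, h2, h3, h4, h5⟩ := hH.exists_exit hG hC subset_rfl
    (show (attach G C H).card ≤ 2 by omega) ⟨v, hv, hdis v hv⟩
  rcases h5 with h5 | h5
  · exact h2 h5
  · exact h3 (mem_attach.2 ⟨h5, v, hv, h4⟩)

lemma IsComp.two_le_attach_special {C H : Finset V} (hG : ThreeConn G) (hC : 3 ≤ C.card)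
    (hH : IsComp G C H) {u u' : V} (hu : ∀ v, v ∈ H ↔ v = u ∨ v = u') (hne : u ≠ u') :
    2 ≤ (attach G C {u}).card := by
  by_contra hlt
  have huH : u ∈ H := by simp [hu]
  obtain ⟨v, hv, w, h1, h2, h3, h4, h5⟩ := hH.exists_exit (X := {u}) hG hC (by simpa using huH)
    (show (insert u' (attach G C {u})).card ≤ 2 by
      have := Finset.card_insert_le u' (attach G C {u})
      omega) ⟨u, by simp, by
      simp [hne, mem_attach]⟩
  simp only [Finset.mem_singleton] at hv h2
  subst hv
  rw [Finset.mem_insert, not_or] at h3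
  rcases h5 with h5 | h5
  · rw [hu] at h5
    tauto
  · exact h3.2 (mem_attach.2 ⟨h5, v, by simp, h4⟩)

lemma IsComp.triple_one {C H : Finset V} (hG : ThreeConn G) (hC : 3 ≤ C.card)
    (hH : IsComp G C H) : Triple G C H 1 := by
  obtain ⟨x, hx, y, hy, z, hz, h1, h2, h3⟩ := Finset.two_lt_card.1 (hH.three_le_attach hG hC)
  have link : ∀ x ∈ attach G C H, ∀ y ∈ attach G C H, Link G H x y 1 := by
    intro x hx y hy
    obtain ⟨-, u, hu, hux⟩ := mem_attach.1 hx
    obtain ⟨-, w, hw, hwy⟩ := mem_attach.1 hy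
    exact ⟨u, w, hux.symm, hwy, hH.longPath hu hw⟩
  exact ⟨x, (mem_attach.1 hx).1, y, (mem_attach.1 hy).1, z, (mem_attach.1 hz).1, h1, h2, h3,
    link x hx y hy, link x hx z hz, link y hy z hz⟩

lemma IsComp.triple_of_leaf {C H K : Finset V} {r : V} {d : ℕ} (hG : ThreeConn G)
    (hC : 3 ≤ C.card) (hH : IsComp G C H) (hK : IsLeaf G H K r) (hK2 : 2 ≤ K.card)
    (hd : ∀ v ∈ K, d ≤ degIn G H v) : Triple G C H (d + 1) := by
  have hr := hK.root_mem
  let E : V → V → Prop := fun u x => (u ∈ K ∧ G.Adj u x) ∨ (u = r ∧ ∃ z ∈ H, z ∉ K ∧ G.Adj z x)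
  have hFH : insert r K ⊆ H := by
    intro v hv
    rcases Finset.mem_insert.1 hv with rfl | hv
    · exact hr.1
    · exact hK.sub hv
  obtain ⟨u, hu, v, hv, w, hw, x, hx, y, hy, z, hz, huv, huw, hvw, hxy, hxz, hyz, hux, hvy, hwz⟩ :=
    exists_matching_three (insert r K) C E (by
      intro S₁ hS₁ S₂ hS₂ hcov
      by_contra hlt
      have hS : (S₁ ∪ S₂).card ≤ 2 := (Finset.card_union_le _ _).trans (by omega)
      have hHS₂ : ∀ v ∈ H, v ∉ S₂ := fun v hv h => Finset.disjoint_left.1 hH.disj hv (hS₂ h)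
      by_cases hrS : r ∈ S₁
      · have hex : ∃ v ∈ K, v ∉ S₁ ∪ S₂ := by
          by_contra hn
          push Not at hn
          have : insert r K ⊆ S₁ := by
            intro v hv
            rcases Finset.mem_insert.1 hv with rfl | hv
            · exact hrS
            · exact (Finset.mem_union.1 (hn v hv)).resolve_right (hHS₂ v (hK.sub hv))
          have := Finset.card_le_card this
          rw [Finset.card_insert_of_notMem hr.2] at this
          omega
        obtain ⟨v, hv, w, h1, h2, h3, h4, h5⟩ := hH.exists_exit hG hC hK.sub hS hex
        rw [Finset.mem_union, not_or] at h1 h3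
        rcases h5 with h5 | h5
        · exact h3.1 (hK.eq_root hv h5 h2 h4 ▸ hrS)
        · exact h3.2 (hcov v (by simp [hv]) h1.1 w h5 (Or.inl ⟨hv, h4⟩))
      · obtain ⟨v, hv, w, h1, h2, h3, h4, h5⟩ := hH.exists_exit hG hC subset_rfl hS
          ⟨r, hr.1, by simp [hrS, hHS₂ r hr.1]⟩
        rw [Finset.mem_union, not_or] at h1 h3
        have hwC := h5.resolve_left h2
        by_cases hvK : v ∈ K
        · exact h3.2 (hcov v (by simp [hvK]) h1.1 w hwC (Or.inl ⟨hvK, h4⟩))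
        · exact h3.2 (hcov r (by simp) hrS w hwC (Or.inr ⟨rfl, v, hv, hvK, h4⟩)))
  have root : ∀ v y x, v ∈ insert r K → r ≠ v → (∃ z ∈ H, z ∉ K ∧ G.Adj z x) → G.Adj v y →
      Link G H x y (d + 1) := by
    intro v y x hv hrv hx hvy
    obtain ⟨z, hz, hzK, hzx⟩ := hx
    refine ⟨z, v, hzx.symm, hvy, ((hK.longPath_root hH hz hzK).symm.glue
      (hK.longPath hK2 hd (by simp) hv hrv) ?_ ?_ (by omega))⟩
    · intro t ht
      simp at ht ⊢
      tauto
    · exact Finset.union_subset Finset.sdiff_subset hFH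
  have link : ∀ u ∈ insert r K, ∀ v ∈ insert r K, ∀ x y, u ≠ v → E u x → E v y →
      Link G H x y (d + 1) := by
    intro p hp q hq x y hpq hpx hqy
    rcases hpx with ⟨hpK, hpx⟩ | ⟨hpr, hrx⟩
    · rcases hqy with ⟨hqK, hqy⟩ | ⟨hqr, hry⟩
      · exact ⟨p, q, hpx.symm, hqy, (hK.longPath hK2 hd hp hq hpq).mono hFH le_rfl⟩
      · exact (root p x y hp (hqr ▸ hpq.symm) hry hpx).symm
    · rcases hqy with ⟨hqK, hqy⟩ | ⟨hqr, hry⟩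
      · exact root q y x hq (hpr ▸ hpq) hrx hqy
      · exact absurd (hpr.trans hqr.symm) hpq
  exact ⟨x, hx, y, hy, z, hz, hxy, hxz, hyz, link u hu v hv x y huv hux hvy,
    link u hu w hw x z huw hux hwz, link v hv w hw y z hvw hvy hwz⟩

lemma IsComp.triple_two {C H : Finset V} (hG : ThreeConn G)
    (hC : 3 ≤ C.card) (hH : IsComp G C H) (hH3 : 3 ≤ H.card) : Triple G C H 2 := by
  obtain ⟨u, hu, v, hv, w, hw, x, hx, y, hy, z, hz, huv, huw, hvw, hxy, hxz, hyz, hux, hvy, hwz⟩ :=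
    exists_matching_three H C G.Adj (by
      intro S₁ hS₁ S₂ hS₂ hcov
      by_contra hlt
      have hS : (S₁ ∪ S₂).card ≤ 2 := (Finset.card_union_le _ _).trans (by omega)
      have hex : ∃ v ∈ H, v ∉ S₁ ∪ S₂ := by
        by_contra hn
        push Not at hn
        have := Finset.card_le_card hn
        omega
      obtain ⟨v, hv, w, h1, h2, h3, h4, h5⟩ := hH.exists_exit hG hC subset_rfl hS hex
      rw [Finset.mem_union, not_or] at h1 h3
      exact h3.2 (hcov v hv h1.1 w (h5.resolve_left h2) h4))
  have link : ∀ u ∈ H, ∀ v ∈ H, ∀ x y, u ≠ v → G.Adj u x → G.Adj v y → Link G H x y 2 :=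
    fun u hu v hv x y huv hux hvy => ⟨u, v, hux.symm, hvy, (hH.longPath hu hv).two_le huv⟩
  exact ⟨x, hx, y, hy, z, hz, hxy, hxz, hyz, link u hu v hv x y huv hux hvy,
    link u hu w hw x z huw hux hwz, link v hv w hw y z hvw hvy hwz⟩

lemma IsComp.triple_two_of_common {C H : Finset V} (hG : ThreeConn G)
    (hC : 3 ≤ C.card) (hH : IsComp G C H) {u u' x : V} (hu : ∀ v, v ∈ H ↔ v = u ∨ v = u')
    (hne : u ≠ u') (hx : x ∈ C) (hux : G.Adj u x) (hux' : G.Adj u' x) : Triple G C H 2 := by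
  have huH : u ∈ H := by simp [hu]
  have huH' : u' ∈ H := by simp [hu]
  have link : ∀ x y, G.Adj u x → G.Adj u' y → Link G H x y 2 :=
    fun x y hux hvy => ⟨u, u', hux.symm, hvy, (hH.longPath huH huH').two_le hne⟩
  have fin : ∀ y ∈ C, ∀ z ∈ C, y ≠ x → z ≠ x → y ≠ z → G.Adj u y → G.Adj u' z →
      Triple G C H 2 := fun y hy z hz hyx hzx hyz huy huz =>
    ⟨x, hx, y, hy, z, hz, hyx.symm, hzx.symm, hyz, (link y x huy hux').symm, link x z hux huz,
      link y z huy huz⟩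
  have h1 := hH.two_le_attach_special hG hC hu hne
  have h2 := hH.two_le_attach_special hG hC (fun v => (hu v).trans or_comm) hne.symm
  have h3 := hH.three_le_attach hG hC
  obtain ⟨y, hy, hyx⟩ := Finset.exists_mem_ne h1 x
  obtain ⟨z, hz, hzx⟩ := Finset.exists_mem_ne h2 x
  simp [mem_attach] at hy hz
  by_cases hyz : y = z
  · subst hyz
    obtain ⟨t, ht, htn⟩ := Finset.exists_mem_notMem_of_card_lt_card
      (lt_of_le_of_lt (Finset.card_le_two (a := x) (b := y)) h3)
    simp at htn
    obtain ⟨htC, w, hw, hwt⟩ := mem_attach.1 ht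
    rcases (hu w).1 hw with rfl | rfl
    · exact fin t htC y hy.1 htn.1 hyx htn.2 hwt hz.2
    · exact fin y hy.1 t htC hyx htn.1 (Ne.symm htn.2) hy.2 hwt
  · exact fin y hy.1 z hz.1 hyx hzx hyz hy.2 hz.2

/-- Every component of the complement of a cycle contains, for each of its vertices `w`, a vertex
`b` of small degree that is joined to `w` by a long path, while the component itself offers long
connections between three vertices of the cycle. -/
theorem IsComp.exists_end {C H : Finset V} (hG : ThreeConn G) (hC : 3 ≤ C.card)
    (hH : IsComp G C H) {w : V} (hw : w ∈ H) :
    ∃ b ∈ H, LongPath G H w b (degIn G H b + 1) ∧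
      (Triple G C H (degIn G H b + 1) ∨ (IsSpecial G C H ∧ degIn G H b = 1)) := by
  by_cases h2 : ∃ v ∈ H, v ≠ w
  · obtain ⟨K, r, hK, hwK⟩ := hH.exists_isLeaf hw h2
    obtain ⟨b, hb, hmin⟩ := Finset.exists_min_image K (degIn G H) hK.nonempty
    have hr := hK.root_mem
    have hFH : insert r K ⊆ H := by
      intro v hv
      rcases Finset.mem_insert.1 hv with rfl | hv
      · exact hr.1
      · exact hK.sub hv
    have hrb : r ≠ b := fun h => hr.2 (h ▸ hb)
    refine ⟨b, hK.sub hb, ?_⟩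
    by_cases hK2 : 2 ≤ K.card
    · refine ⟨?_, Or.inl (hH.triple_of_leaf hG hC hK hK2 hmin)⟩
      refine (hK.longPath_root hH hw hwK).symm.glue
        (hK.longPath hK2 hmin (by simp) (by simp [hb]) hrb) ?_ ?_ (by omega)
      · intro t ht
        simp at ht ⊢
        tauto
      · exact Finset.union_subset Finset.sdiff_subset hFH
    · obtain ⟨b', hb'⟩ : ∃ b, K = {b} := Finset.card_eq_one.1
        (le_antisymm (by omega) hK.nonempty.card_pos)
      have : b' = b := by
        rw [hb', Finset.mem_singleton] at hb
        exact hb.symm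
      subst this
      have hbr : G.Adj b' r := by
        have : r ∈ bd G H K := by simp [hK.bd_eq]
        simpa [mem_bd, hb'] using (mem_bd.1 this).2.2
      have hdeg : degIn G H b' = 1 := by
        classical
        refine Finset.card_eq_one.2 ⟨r, ?_⟩
        ext v
        rw [Finset.mem_filter, Finset.mem_singleton]
        constructor
        · rintro ⟨h1, h2⟩
          exact hK.eq_root hb h1 (by rw [hb']; simpa using h2.ne') h2
        · rintro rfl
          exact ⟨hr.1, hbr⟩
      rw [hdeg]
      refine ⟨(hH.longPath hw (hK.sub hb)).two_le (fun h => hwK (h ▸ hb)), ?_⟩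
      by_cases hH3 : 3 ≤ H.card
      · exact Or.inl (hH.triple_two hG hC hH3)
      · have hHe : {b', r} = H := by
          apply Finset.eq_of_subset_of_card_le
          · intro v hv
            simp at hv
            rcases hv with rfl | rfl
            · exact hK.sub hb
            · exact hr.1
          · rw [Finset.card_pair hrb.symm]
            omega
        have hu : ∀ v, v ∈ H ↔ v = b' ∨ v = r := fun v => by simp [← hHe]
        by_cases hcom : ∃ x ∈ C, G.Adj b' x ∧ G.Adj r x
        · obtain ⟨x, hx, h1, h2⟩ := hcom
          exact Or.inl (hH.triple_two_of_common hG hC hu hrb.symm hx h1 h2)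
        · push Not at hcom
          exact Or.inr ⟨⟨b', r, hrb.symm, hu, hbr, hcom⟩, rfl⟩
  · push Not at h2
    have hdeg : degIn G H w = 0 := by
      classical
      refine Finset.card_eq_zero.2 (Finset.filter_eq_empty_iff.2 fun v hv h => ?_)
      exact h.ne' (h2 v hv)
    refine ⟨w, hw, ?_⟩
    rw [hdeg]
    exact ⟨LongPath.single hw, Or.inl (hH.triple_one hG hC)⟩

end Structure

section SegmentBound

/-- The excess over `2` of the number of pairs of roles among three whose union occurs. -/
def excess (p q r : Bool) : ℤ :=
  (if p || q then 1 else 0) + (if p || r then 1 else 0) + (if q || r then 1 else 0) - 2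

/-- Potential used when the second and third roles are unrestricted. -/
def potFree (p q r : Bool) : ℤ :=
  if q && !p then 0 else if r || q then -1 else -2

/-- Potential used when the second role never occurs twice in a row. -/
def potSecond (p q r : Bool) : ℤ :=
  if q && r && !p then 0 else if q || r then -1 else -2

/-- Potential used when the third role never occurs twice in a row. -/
def potThird (p q r : Bool) : ℤ :=
  if q || (p && r) then -1 else -2

variable {V : Type*}

lemma isChain_of_split {R : V → V → Prop} {l : List V}
    (h : ∀ X v w Y, l = X ++ v :: w :: Y → R v w) : l.IsChain R := by
  induction l with
  | nil => exact List.isChain_nil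
  | cons a t ih =>
    cases t with
    | nil => exact List.isChain_singleton a
    | cons b t =>
      rw [List.isChain_cons_cons]
      exact ⟨h [] a b t rfl, ih fun X v w Y e => h (a :: X) v w Y (by rw [e]; rfl)⟩

lemma sum_le_of_isChain {R : V → V → Prop} {e φ : V → ℤ} (hR : ∀ v w, R v w → φ v + e w ≤ φ w) :
    ∀ (l : List V) (v : V), (v :: l).IsChain R →
      φ v + (l.map e).sum ≤ φ ((v :: l).getLast (by simp)) := by
  intro l
  induction l with
  | nil => simp
  | cons w t ih =>
    intro v h
    rw [List.isChain_cons_cons] at h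
    have h1 := hR v w h.1
    have h2 := ih w h.2
    rw [List.map_cons, List.sum_cons, List.getLast_cons (by simp)]
    linarith

/-- The transition rule between consecutive vertices of a segment. -/
def Step (N₁ N₂ N₃ : V → Bool) (q r : ℕ) (v w : V) : Prop :=
  ((N₂ v || N₃ v) = true → N₁ w = false) ∧ (N₂ v = true → N₃ w = false) ∧
  (1 ≤ q → N₂ v = true → N₂ w = false) ∧ (1 ≤ r → N₃ v = true → N₃ w = false)

lemma exists_first {N : V → Bool} (l : List V) :
    (∀ v ∈ l, N v = false) ∨ ∃ M v Y, l = M ++ v :: Y ∧ N v = true ∧ ∀ u ∈ M, N u = false := by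
  induction l with
  | nil => simp
  | cons a t ih =>
    by_cases ha : N a = true
    · exact Or.inr ⟨[], a, t, rfl, ha, by simp⟩
    · rw [Bool.not_eq_true] at ha
      rcases ih with ih | ⟨M, v, Y, rfl, hv, hM⟩
      · exact Or.inl (by simpa [ha] using ih)
      · exact Or.inr ⟨a :: M, v, Y, rfl, hv, by simpa [ha] using hM⟩

lemma sum_map_const {e : V → ℤ} {k : ℤ} (l : List V) (h : ∀ v ∈ l, e v = k) :
    (l.map e).sum = k * l.length := by
  induction l with
  | nil => simp
  | cons a t ih =>
    rw [List.map_cons, List.sum_cons, h a (by simp), ih fun v hv => h v (by simp [hv])]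
    push_cast [List.length_cons]
    ring

/-- The basic inequality for one segment, given a potential `φ` adapted to the transition rule. -/
lemma segment_le_potential {N₁ N₂ N₃ : V → Bool} {a : V} {T : List V} {D d p q r : ℕ}
    {φ : Bool → Bool → Bool → ℤ} {β : ℤ}
    (hstep : (a :: T).IsChain (Step N₁ N₂ N₃ q r))
    (h₂ : ∀ M v Y, a :: T = M ++ v :: Y → N₂ v = true → d + 1 + q ≤ M.length)
    (h₃ : ∀ M v Y, a :: T = M ++ v :: Y → N₃ v = true → d + 1 + r ≤ M.length)
    (h₁ : ∀ M v Y, T = M ++ v :: Y → N₁ v = true → p ≤ M.length)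
    (hT : d + 1 ≤ T.length) (hD : D ≤ d)
    (hp₀ : p = 0 → D = 0 ∧ N₁ a = false) (hp : 1 ≤ p → D + 1 ≤ p)
    (hφ : ∀ v w, Step N₁ N₂ N₃ q r v w → φ (N₁ v) (N₂ v) (N₃ v) + excess (N₁ w) (N₂ w) (N₃ w) ≤
      φ (N₁ w) (N₂ w) (N₃ w))
    (hφ₀ : ∀ b₁ b₂ b₃, -2 ≤ φ b₁ b₂ b₃) (hφ₁ : φ false false false = -2)
    (hφ₂ : 0 ≤ φ false true false + 2 * q + 1) (hφ₃ : 0 ≤ φ false false true + 2 * r + 1)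
    (hφ₄ : 0 ≤ φ false true true + 2 * max q r)
    (hβ : ∀ h, φ (N₁ ((a :: T).getLast h)) (N₂ ((a :: T).getLast h)) (N₃ ((a :: T).getLast h)) ≤ β)
    (hβ₂ : -2 ≤ β) :
    ((a :: T).map fun v => excess (N₁ v) (N₂ v) (N₃ v)).sum + 2 * D ≤
      β + if 1 ≤ p then 1 else 0 := by
  have ha₂ : N₂ a = false := by
    by_contra h
    have := h₂ [] a T rfl (by simpa using h)
    simp at this
  have ha₃ : N₃ a = false := by
    by_contra h
    have := h₃ [] a T rfl (by simpa using h)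
    simp at this
  have hβ' := hβ (by simp)
  by_cases hp1 : 1 ≤ p
  · rw [if_pos hp1]
    have hD1 := hp hp1
    have hea : excess (N₁ a) (N₂ a) (N₃ a) ≤ 0 := by
      rw [ha₂, ha₃]
      cases N₁ a <;> decide
    rw [List.map_cons, List.sum_cons]
    rcases exists_first (N := fun v => N₁ v || N₂ v || N₃ v) T with hno | ⟨M, v, Y, rfl, hv, hM⟩
    · rw [sum_map_const (k := -2) T]
      · omega
      · intro v hv
        have := hno v hv
        simp only [Bool.or_eq_false_iff] at this
        rw [this.1.1, this.1.2, this.2]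
        decide
    · rw [List.map_append, List.sum_append, sum_map_const (k := -2) M]
      · rw [List.map_cons, List.sum_cons]
        have hch : (v :: Y).IsChain (Step N₁ N₂ N₃ q r) := by
          have := (List.isChain_append (l₁ := a :: M) (l₂ := v :: Y)).1 (by simpa using hstep)
          exact this.2.1
        have hs := sum_le_of_isChain (e := fun v => excess (N₁ v) (N₂ v) (N₃ v))
          (φ := fun v => φ (N₁ v) (N₂ v) (N₃ v)) hφ Y v hch
        have hl : (a :: (M ++ v :: Y)).getLast (by simp) = (v :: Y).getLast (by simp) := by
          rw [List.getLast_cons (by simp), List.getLast_append_of_ne_nil _ (by simp)]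
        rw [hl] at hβ'
        have hv₁ := h₁ M v Y rfl
        have hv₂ := h₂ (a :: M) v Y rfl
        have hv₃ := h₃ (a :: M) v Y rfl
        simp only [List.length_cons] at hv₂ hv₃
        have key : excess (N₁ v) (N₂ v) (N₃ v) + 2 * D ≤
            φ (N₁ v) (N₂ v) (N₃ v) + 1 + 2 * M.length := by
          have h0 := hφ₀ (N₁ v) (N₂ v) (N₃ v)
          cases e₁ : N₁ v <;> cases e₂ : N₂ v <;> cases e₃ : N₃ v <;>
            simp only [e₁, e₂, e₃, excess, Bool.or_true, Bool.or_false, if_true, if_false,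
              forall_const, Bool.false_eq_true, IsEmpty.forall_iff] at hv hv₁ hv₂ hv₃ h0 ⊢ <;> omega
        linarith
      · intro u hu
        have := hM u hu
        simp only [Bool.or_eq_false_iff] at this
        rw [this.1.1, this.1.2, this.2]
        decide
  · rw [if_neg hp1]
    obtain ⟨hD0, ha₁⟩ := hp₀ (by omega)
    have hs := sum_le_of_isChain (e := fun v => excess (N₁ v) (N₂ v) (N₃ v))
      (φ := fun v => φ (N₁ v) (N₂ v) (N₃ v)) hφ T a hstep
    rw [List.map_cons, List.sum_cons]
    have hea : excess (N₁ a) (N₂ a) (N₃ a) = φ (N₁ a) (N₂ a) (N₃ a) := by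
      rw [ha₁, ha₂, ha₃, hφ₁]
      decide
    simp only [hD0, hea]
    push_cast
    linarith

/-- The total excess of a segment. -/
lemma segment_bound {N₁ N₂ N₃ : V → Bool} {a : V} {T : List V} {D d p q r : ℕ}
    (hstep : (a :: T).IsChain (Step N₁ N₂ N₃ q r))
    (h₂ : ∀ M v Y, a :: T = M ++ v :: Y → N₂ v = true → d + 1 + q ≤ M.length)
    (h₃ : ∀ M v Y, a :: T = M ++ v :: Y → N₃ v = true → d + 1 + r ≤ M.length)
    (h₁ : ∀ M v Y, T = M ++ v :: Y → N₁ v = true → p ≤ M.length)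
    (hT : d + 1 ≤ T.length) (hD : D ≤ d)
    (hp₀ : p = 0 → D = 0 ∧ N₁ a = false) (hp : 1 ≤ p → D + 1 ≤ p)
    (hlast : 1 ≤ q → ∀ h, N₂ ((a :: T).getLast h) = false) :
    ((a :: T).map fun v => excess (N₁ v) (N₂ v) (N₃ v)).sum + 2 * D ≤
      (if 1 ≤ p then 1 else 0) - if 1 ≤ q ∨ 1 ≤ r then 1 else 0 := by
  by_cases hq : 1 ≤ q
  · have := segment_le_potential (φ := potSecond) (β := -1) hstep h₂ h₃ h₁ hT hD hp₀ hp ?_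
      (by decide) (by decide) ?_ ?_ ?_ ?_ (by decide)
    · rw [if_pos (Or.inl hq)]
      omega
    · rintro v w ⟨s1, s2, s3, -⟩
      have s3 := s3 hq
      revert s1 s2 s3
      generalize N₁ v = x
      generalize N₂ v = y
      generalize N₃ v = z
      generalize N₁ w = x'
      generalize N₂ w = y'
      generalize N₃ w = z'
      revert x y z x' y' z'
      decide
    · norm_num [potSecond]
    · norm_num [potSecond]
    · simp [potSecond]
    · intro h
      rw [hlast hq h]
      generalize N₁ _ = x
      generalize N₃ _ = z
      revert x z
      decide
  · by_cases hr : 1 ≤ r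
    · have := segment_le_potential (φ := potThird) (β := -1) hstep h₂ h₃ h₁ hT hD hp₀ hp ?_
        (by decide) (by decide) ?_ ?_ ?_ ?_ (by decide)
      · rw [if_pos (Or.inr hr)]
        omega
      · rintro v w ⟨s1, s2, -, s3⟩
        have s3 := s3 hr
        revert s1 s2 s3
        generalize N₁ v = x
        generalize N₂ v = y
        generalize N₃ v = z
        generalize N₁ w = x'
        generalize N₂ w = y'
        generalize N₃ w = z'
        revert x y z x' y' z'
        decide
      · norm_num [potThird]
      · norm_num [potThird]
        omega
      · norm_num [potThird]
        omega
      · intro h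
        generalize N₁ _ = x
        generalize N₂ _ = y
        generalize N₃ _ = z
        revert x y z
        decide
    · have := segment_le_potential (φ := potFree) (β := 0) hstep h₂ h₃ h₁ hT hD hp₀ hp ?_
        (by decide) (by decide) ?_ ?_ ?_ ?_ (by decide)
      · rw [if_neg (show ¬ (1 ≤ q ∨ 1 ≤ r) by omega)]
        omega
      · rintro v w ⟨s1, s2, -, -⟩
        revert s1 s2
        generalize N₁ v = x
        generalize N₂ v = y
        generalize N₃ v = z
        generalize N₁ w = x'
        generalize N₂ w = y'
        generalize N₃ w = z'
        revert x y z x' y' z'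
        decide
      · norm_num [potFree]
        omega
      · norm_num [potFree]
      · simp [potFree]
      · intro h
        generalize N₁ _ = x
        generalize N₂ _ = y
        generalize N₃ _ = z
        revert x y z
        decide

end SegmentBound

section Surgery

variable {V : Type*} {G : SimpleGraph V}

/-- The vertices of `l` in order form a cycle of `G` (or a single edge). -/
def LCycle (G : SimpleGraph V) (l : List V) : Prop :=
  l.Nodup ∧ ∃ u v, LWalk G l u v ∧ G.Adj v u

lemma LWalk.glue {l t : List V} {u v w : V} (h₁ : LWalk G l u v) (h₂ : LWalk G (v :: t) v w) :
    LWalk G (l ++ t) u w := by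
  cases t with
  | nil =>
    have := h₂.2.2
    simp at this
    subst this
    simpa using h₁
  | cons d t =>
    exact h₁.append (LWalk.split (X := []) h₂).2 (by have := h₂.1; simp at this; exact this.1)

variable [DecidableEq V]

lemma nodup_of_count_le {l l' : List V} (h : ∀ a, l'.count a ≤ l.count a) (hl : l.Nodup) :
    l'.Nodup :=
  List.nodup_iff_count_le_one.2 fun a => (h a).trans (List.nodup_iff_count_le_one.1 hl a)

/-- A longest cycle cut into three segments at the attachments `x₁, x₂, x₃` of a component `H`,
with a path `Pᵢ` outside the cycle leading from the first vertex `aᵢ` of each segment to `bᵢ`. -/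
structure Roles (G : SimpleGraph V) (c d : ℕ) (H : Finset V) (S₁ S₂ S₃ P₁ P₂ P₃ : List V)
    (x₁ x₂ x₃ a₁ a₂ a₃ b₁ b₂ b₃ : V) : Prop where
  walk₁ : LWalk G S₁ a₁ x₂
  walk₂ : LWalk G S₂ a₂ x₃
  walk₃ : LWalk G S₃ a₃ x₁
  adj₁ : G.Adj x₁ a₁
  adj₂ : G.Adj x₂ a₂
  adj₃ : G.Adj x₃ a₃
  link₁₂ : Link G H x₁ x₂ (d + 1)
  link₂₃ : Link G H x₂ x₃ (d + 1)
  link₃₁ : Link G H x₃ x₁ (d + 1)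
  leg₁ : LWalk G (a₁ :: P₁) a₁ b₁
  leg₂ : LWalk G (a₂ :: P₂) a₂ b₂
  leg₃ : LWalk G (a₃ :: P₃) a₃ b₃
  nodup : (S₁ ++ S₂ ++ S₃ ++ P₁ ++ P₂ ++ P₃).Nodup
  notMem : ∀ v ∈ S₁ ++ S₂ ++ S₃ ++ P₁ ++ P₂ ++ P₃, v ∉ H
  length_eq : S₁.length + S₂.length + S₃.length = c
  length_le : ∀ l, LCycle G l → l.length ≤ c

namespace Roles

variable {c d : ℕ} {H : Finset V} {S₁ S₂ S₃ P₁ P₂ P₃ : List V}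
  {x₁ x₂ x₃ a₁ a₂ a₃ b₁ b₂ b₃ : V}

lemma rotate (h : Roles G c d H S₁ S₂ S₃ P₁ P₂ P₃ x₁ x₂ x₃ a₁ a₂ a₃ b₁ b₂ b₃) :
    Roles G c d H S₂ S₃ S₁ P₂ P₃ P₁ x₂ x₃ x₁ a₂ a₃ a₁ b₂ b₃ b₁ := by
  refine ⟨h.walk₂, h.walk₃, h.walk₁, h.adj₂, h.adj₃, h.adj₁, h.link₂₃, h.link₃₁, h.link₁₂,
    h.leg₂, h.leg₃, h.leg₁, nodup_of_count_le ?_ h.nodup, ?_, ?_, h.length_le⟩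
  · intro a
    simp only [List.count_append]
    omega
  · intro v hv
    apply h.notMem
    simp only [List.mem_append] at hv ⊢
    tauto
  · have := h.length_eq
    omega

lemma length_le_of_count (h : Roles G c d H S₁ S₂ S₃ P₁ P₂ P₃ x₁ x₂ x₃ a₁ a₂ a₃ b₁ b₂ b₃)
    {l L : List V} {u v : V} (hw : LWalk G l u v) (hvu : G.Adj v u) (hL : L.Nodup)
    (hLH : ∀ v ∈ L, v ∈ H)
    (hcount : ∀ a, l.count a ≤ (S₁ ++ S₂ ++ S₃ ++ P₁ ++ P₂ ++ P₃ ++ L).count a) :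
    l.length ≤ c := by
  refine h.length_le l ⟨nodup_of_count_le hcount ?_, u, v, hw, hvu⟩
  rw [List.nodup_append']
  exact ⟨h.nodup, hL, fun a ha ha' => h.notMem a ha (hLH a ha')⟩

lemma not_adj_ends (h : Roles G c d H S₁ S₂ S₃ P₁ P₂ P₃ x₁ x₂ x₃ a₁ a₂ a₃ b₁ b₂ b₃) :
    ¬ G.Adj b₁ b₂ := by
  intro hb
  obtain ⟨u, w, hu, hw, L, hL, hL1, hL2, hL3⟩ := h.link₁₂.symm
  have w1 := (((h.walk₁.reverse.glue h.leg₁).reverse.append hL hu).append h.walk₃.reverse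
    hw).append (h.walk₂.reverse.glue h.leg₂) h.adj₃.symm
  have := h.length_le_of_count w1 hb.symm hL1 hL2 (fun a => by
    simp only [List.count_append, List.count_reverse]
    omega)
  have := h.length_eq
  simp only [List.length_append, List.length_reverse] at *
  omega

lemma ends_ne (h : Roles G c d H S₁ S₂ S₃ P₁ P₂ P₃ x₁ x₂ x₃ a₁ a₂ a₃ b₁ b₂ b₃) : b₁ ≠ b₂ := by
  have m1 := h.leg₁.last_mem
  have m2 := h.leg₂.last_mem
  have m3 := h.walk₁.head_mem
  have m4 := h.walk₂.head_mem
  have hn := h.nodup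
  rintro rfl
  have m5 : b₁ ∈ S₁ ∨ b₁ ∈ P₁ := by
    rcases List.mem_cons.1 m1 with h | h
    · exact Or.inl (h ▸ m3)
    · exact Or.inr h
  have m6 : b₁ ∈ S₂ ∨ b₁ ∈ P₂ := by
    rcases List.mem_cons.1 m2 with h | h
    · exact Or.inl (h ▸ m4)
    · exact Or.inr h
  have hc := List.nodup_iff_count_le_one.1 hn b₁
  simp only [List.count_append] at hc
  rw [← List.one_le_count_iff, ← List.one_le_count_iff] at m5 m6
  omega

lemma not_adj_second_first {X Y : List V} {v w : V}
    (h : Roles G c d H (X ++ v :: w :: Y) S₂ S₃ P₁ P₂ P₃ x₁ x₂ x₃ a₁ a₂ a₃ b₁ b₂ b₃)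
    (hv : G.Adj b₂ v) : ¬ G.Adj b₁ w := by
  intro hw
  obtain ⟨s1, s2⟩ := h.walk₁.split
  obtain ⟨u, z, hu, hz, L, hL, hL1, hL2, hL3⟩ := h.link₁₂.symm
  have w1 := (((s2.append hL hu).append h.walk₃.reverse hz).append
    (h.walk₂.reverse.glue h.leg₂) h.adj₃.symm).append (s1.reverse.glue h.leg₁) hv
  have := h.length_le_of_count w1 hw hL1 hL2 (fun a => by
    simp only [List.count_append, List.count_reverse, List.count_cons, List.count_nil]
    omega)
  have := h.length_eq
  simp only [List.length_append, List.length_reverse, List.length_cons, List.length_nil] at *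
  omega

lemma not_adj_third_first {X Y : List V} {v w : V}
    (h : Roles G c d H (X ++ v :: w :: Y) S₂ S₃ P₁ P₂ P₃ x₁ x₂ x₃ a₁ a₂ a₃ b₁ b₂ b₃)
    (hv : G.Adj b₃ v) : ¬ G.Adj b₁ w := by
  intro hw
  obtain ⟨s1, s2⟩ := h.walk₁.split
  obtain ⟨u, z, hu, hz, L, hL, hL1, hL2, hL3⟩ := h.link₃₁
  have w1 := (((s2.append h.walk₂ h.adj₂).append hL hu).append
    (h.walk₃.reverse.glue h.leg₃) hz).append (s1.reverse.glue h.leg₁) hv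
  have := h.length_le_of_count w1 hw hL1 hL2 (fun a => by
    simp only [List.count_append, List.count_reverse, List.count_cons, List.count_nil]
    omega)
  have := h.length_eq
  simp only [List.length_append, List.length_reverse, List.length_cons, List.length_nil] at *
  omega

lemma not_adj_second_third {X Y : List V} {v w : V}
    (h : Roles G c d H (X ++ v :: w :: Y) S₂ S₃ P₁ P₂ P₃ x₁ x₂ x₃ a₁ a₂ a₃ b₁ b₂ b₃)
    (hv : G.Adj b₂ v) : ¬ G.Adj b₃ w := by
  intro hw
  obtain ⟨s1, s2⟩ := h.walk₁.split
  obtain ⟨u, z, hu, hz, L, hL, hL1, hL2, hL3⟩ := h.link₂₃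
  have w1 := (((s2.append hL hu).append (h.walk₂.reverse.glue h.leg₂) hz).append
    s1.reverse hv).append (h.walk₃.reverse.glue h.leg₃) h.adj₁.symm
  have := h.length_le_of_count w1 hw hL1 hL2 (fun a => by
    simp only [List.count_append, List.count_reverse, List.count_cons, List.count_nil]
    omega)
  have := h.length_eq
  simp only [List.length_append, List.length_reverse, List.length_cons, List.length_nil] at *
  omega

lemma le_of_adj_second {M Y : List V} {v : V}
    (h : Roles G c d H (M ++ v :: Y) S₂ S₃ P₁ P₂ P₃ x₁ x₂ x₃ a₁ a₂ a₃ b₁ b₂ b₃)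
    (hv : G.Adj b₂ v) : d + 1 + P₂.length ≤ M.length := by
  obtain ⟨-, s2⟩ := h.walk₁.splitAt
  obtain ⟨u, z, hu, hz, L, hL, hL1, hL2, hL3⟩ := h.link₁₂
  have w1 := ((s2.reverse.append (h.walk₂.reverse.glue h.leg₂).reverse hv.symm).append h.walk₃
    h.adj₃).append hL hu
  have := h.length_le_of_count w1 hz hL1 hL2 (fun a => by
    simp only [List.count_append, List.count_reverse, List.count_cons]
    omega)
  have := h.length_eq
  simp only [List.length_append, List.length_reverse, List.length_cons] at *
  omega

lemma le_of_adj_third {M Y : List V} {v : V}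
    (h : Roles G c d H (M ++ v :: Y) S₂ S₃ P₁ P₂ P₃ x₁ x₂ x₃ a₁ a₂ a₃ b₁ b₂ b₃)
    (hv : G.Adj b₃ v) : d + 1 + P₃.length ≤ M.length := by
  obtain ⟨-, s2⟩ := h.walk₁.splitAt
  obtain ⟨u, z, hu, hz, L, hL, hL1, hL2, hL3⟩ := h.link₃₁.symm
  have w1 := ((h.walk₂.reverse.append s2.reverse h.adj₂.symm).append
    (h.walk₃.reverse.glue h.leg₃).reverse hv.symm).append hL hu
  have := h.length_le_of_count w1 hz hL1 hL2 (fun a => by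
    simp only [List.count_append, List.count_reverse, List.count_cons]
    omega)
  have := h.length_eq
  simp only [List.length_append, List.length_reverse, List.length_cons] at *
  omega

lemma le_of_adj_first {M Y : List V} {w : V}
    (h : Roles G c d H (a₁ :: (M ++ w :: Y)) S₂ S₃ P₁ P₂ P₃ x₁ x₂ x₃ a₁ a₂ a₃ b₁ b₂ b₃)
    (hw : G.Adj b₁ w) : P₁.length ≤ M.length := by
  obtain ⟨-, s2⟩ := LWalk.splitAt (X := a₁ :: M) h.walk₁
  have w1 := ((h.leg₁.append s2 hw).append h.walk₂ h.adj₂).append h.walk₃ h.adj₃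
  have := h.length_le_of_count w1 h.adj₁ List.nodup_nil (by simp) (fun a => by
    simp only [List.count_append, List.count_cons]
    omega)
  have := h.length_eq
  simp only [List.length_append, List.length_cons] at *
  omega

lemma not_adj_twice {X Y : List V} {v w b : V}
    (h : Roles G c d H (X ++ v :: w :: Y) S₂ S₃ P₁ P₂ P₃ x₁ x₂ x₃ a₁ a₂ a₃ b₁ b₂ b₃)
    (hb : b ∈ P₁ ++ P₂ ++ P₃) (hv : G.Adj b v) : ¬ G.Adj b w := by
  intro hw
  obtain ⟨s1, s2⟩ := h.walk₁.split
  have w1 := (((s1.append (LWalk.single b) hv.symm).append s2 hw).append h.walk₂ h.adj₂).append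
    h.walk₃ h.adj₃
  have hb' : ∀ a, [b].count a ≤ (P₁ ++ P₂ ++ P₃).count a := by
    intro a
    by_cases hab : a = b
    · subst hab
      rw [List.count_singleton_self]
      exact List.one_le_count_iff.2 hb
    · simp [Ne.symm hab]
  have := h.length_le_of_count w1 h.adj₁ List.nodup_nil (by simp) (fun a => by
    have := hb' a
    simp only [List.count_append, List.count_cons, List.count_nil] at this ⊢
    omega)
  have := h.length_eq
  simp only [List.length_append, List.length_cons, List.length_nil] at *
  omega

lemma not_adj_last (h : Roles G c d H S₁ S₂ S₃ P₁ P₂ P₃ x₁ x₂ x₃ a₁ a₂ a₃ b₁ b₂ b₃)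
    (hP : P₂ ≠ []) : ¬ G.Adj b₂ x₂ := by
  intro hb
  have w1 := (h.walk₁.append (h.walk₂.reverse.glue h.leg₂).reverse hb.symm).append h.walk₃ h.adj₃
  have := h.length_le_of_count w1 h.adj₁ List.nodup_nil (by simp) (fun a => by
    simp only [List.count_append, List.count_reverse]
    omega)
  have := h.length_eq
  have := List.length_pos_iff.2 hP
  simp only [List.length_append, List.length_reverse] at *
  omega

lemma le_length (h : Roles G c d H S₁ S₂ S₃ P₁ P₂ P₃ x₁ x₂ x₃ a₁ a₂ a₃ b₁ b₂ b₃) :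
    d + 2 ≤ S₁.length := by
  obtain ⟨u, z, hu, hz, L, hL, hL1, hL2, hL3⟩ := h.link₁₂
  have w1 := (((LWalk.single x₂).append h.walk₂ h.adj₂).append h.walk₃ h.adj₃).append hL hu
  have hx : ∀ a, [x₂].count a ≤ S₁.count a := by
    intro a
    by_cases hab : a = x₂
    · subst hab
      simpa using h.walk₁.last_mem
    · simp [Ne.symm hab]
  have := h.length_le_of_count w1 hz hL1 hL2 (fun a => by
    have := hx a
    simp only [List.count_append] at *
    omega)
  have := h.length_eq
  simp only [List.length_append, List.length_cons, List.length_nil] at *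
  omega

end Roles

end Surgery

section RolesCount

variable {V : Type*} {G : SimpleGraph V}

namespace Roles

variable {c d : ℕ} {H : Finset V} {S₁ S₂ S₃ P₁ P₂ P₃ : List V}
  {x₁ x₂ x₃ a₁ a₂ a₃ b₁ b₂ b₃ : V}

lemma eq_of_leg_nil (h : Roles G c d H S₁ S₂ S₃ P₁ P₂ P₃ x₁ x₂ x₃ a₁ a₂ a₃ b₁ b₂ b₃)
    (hP : P₁ = []) : b₁ = a₁ := by
  have := h.leg₁.2.2
  subst hP
  simpa using this.symm

lemma end_mem_leg (h : Roles G c d H S₁ S₂ S₃ P₁ P₂ P₃ x₁ x₂ x₃ a₁ a₂ a₃ b₁ b₂ b₃)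
    (hP : 1 ≤ P₁.length) : b₁ ∈ P₁ := by
  have := h.leg₁.2.2
  rw [List.getLast?_cons_of_ne_nil (by rintro rfl; simp at hP)] at this
  exact List.mem_of_getLast? this

variable [DecidableEq V] [DecidableRel G.Adj]

lemma sum_excess_le (h : Roles G c d H S₁ S₂ S₃ P₁ P₂ P₃ x₁ x₂ x₃ a₁ a₂ a₃ b₁ b₂ b₃) {D : ℕ}
    (hD : D ≤ d) (h₀ : P₁ = [] → D = 0) (h₁ : P₁ ≠ [] → D + 1 ≤ P₁.length) :
    (S₁.map fun v => excess (decide (G.Adj b₁ v)) (decide (G.Adj b₂ v))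
      (decide (G.Adj b₃ v))).sum + 2 * D ≤
      (if 1 ≤ P₁.length then 1 else 0) - if 1 ≤ P₂.length ∨ 1 ≤ P₃.length then 1 else 0 := by
  have hlen := h.le_length
  obtain ⟨T, rfl⟩ := h.walk₁.exists_cons
  refine segment_bound (N₁ := fun v => decide (G.Adj b₁ v)) (N₂ := fun v => decide (G.Adj b₂ v))
    (N₃ := fun v => decide (G.Adj b₃ v)) (D := D) (d := d) (isChain_of_split ?_) ?_ ?_ ?_ ?_ hD
    ?_ ?_ ?_
  · intro X v w Y e
    rw [e] at h
    simp only [Step, Bool.or_eq_true, decide_eq_true_eq, decide_eq_false_iff_not]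
    refine ⟨?_, h.not_adj_second_third, ?_, ?_⟩
    · rintro (hv | hv)
      · exact h.not_adj_second_first hv
      · exact h.not_adj_third_first hv
    · intro hq
      exact h.not_adj_twice (by simp [h.rotate.end_mem_leg hq])
    · intro hr
      exact h.not_adj_twice (by simp [h.rotate.rotate.end_mem_leg hr])
  · intro M v Y e hv
    rw [e] at h
    exact h.le_of_adj_second (by simpa using hv)
  · intro M v Y e hv
    rw [e] at h
    exact h.le_of_adj_third (by simpa using hv)
  · intro M v Y e hv
    rw [e] at h
    exact h.le_of_adj_first (by simpa using hv)
  · simp only [List.length_cons] at hlen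
    omega
  · intro hp
    rw [List.length_eq_zero_iff] at hp
    refine ⟨h₀ hp, ?_⟩
    rw [h.eq_of_leg_nil hp]
    simp
  · intro hp
    exact h₁ (by rintro rfl; simp at hp)
  · intro hq hne
    have := h.walk₁.2.2
    rw [List.getLast?_eq_some_getLast hne, Option.some_inj] at this
    rw [this]
    simpa using h.not_adj_last (by rintro rfl; simp at hq)

end Roles

variable [DecidableEq V] [DecidableRel G.Adj]

lemma excess_rotate (p q r : Bool) : excess q r p = excess p q r := by
  revert p q r
  decide

lemma sum_excess_eq [Fintype V] (l : List V) (hl : l.Nodup) (b₁ b₂ b₃ : V) :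
    (l.map fun v => excess (decide (G.Adj b₁ v)) (decide (G.Adj b₂ v))
      (decide (G.Adj b₃ v))).sum + 2 * l.length =
    ((G.neighborFinset b₁ ∪ G.neighborFinset b₂) ∩ l.toFinset).card +
    ((G.neighborFinset b₁ ∪ G.neighborFinset b₃) ∩ l.toFinset).card +
    ((G.neighborFinset b₂ ∪ G.neighborFinset b₃) ∩ l.toFinset).card := by
  have key : ∀ b b' : V, (((G.neighborFinset b ∪ G.neighborFinset b') ∩ l.toFinset).card : ℤ) =
      ∑ v ∈ l.toFinset, if (decide (G.Adj b v) || decide (G.Adj b' v)) = true then 1 else 0 := by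
    intro b b'
    rw [Finset.sum_boole]
    congr 2
    ext v
    simp [and_comm]
  rw [key, key, key, ← List.sum_toFinset _ hl, ← List.toFinset_card_of_nodup hl]
  simp only [excess, Finset.sum_sub_distrib, Finset.sum_add_distrib, Finset.sum_const]
  simp
  ring

lemma card_union_le_inter [Fintype V] {C : Finset V} {b b' : V} {D D' : ℕ}
    (h : (G.neighborFinset b \ C).card ≤ D) (h' : (G.neighborFinset b' \ C).card ≤ D') :
    (G.neighborFinset b ∪ G.neighborFinset b').card ≤
      ((G.neighborFinset b ∪ G.neighborFinset b') ∩ C).card + D + D' := by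
  rw [← Finset.card_inter_add_card_sdiff _ C, Finset.union_sdiff_distrib]
  have := Finset.card_union_le (G.neighborFinset b \ C) (G.neighborFinset b' \ C)
  omega

lemma Roles.three_mul_le [Fintype V] {c d : ℕ} {H : Finset V} {S₁ S₂ S₃ P₁ P₂ P₃ : List V}
    {x₁ x₂ x₃ a₁ a₂ a₃ b₁ b₂ b₃ : V}
    (h : Roles G c d H S₁ S₂ S₃ P₁ P₂ P₃ x₁ x₂ x₃ a₁ a₂ a₃ b₁ b₂ b₃) {s D₁ D₂ D₃ : ℕ}
    (hs : ∀ u v : V, u ≠ v → ¬ G.Adj u v →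
      s ≤ (G.neighborFinset u ∪ G.neighborFinset v).card)
    {C : Finset V} (hC : ∀ v, v ∈ C ↔ v ∈ S₁ ++ S₂ ++ S₃)
    (hD₁ : D₁ ≤ d) (h₁ : P₁ = [] → D₁ = 0) (h₁' : P₁ ≠ [] → D₁ + 1 ≤ P₁.length)
    (hD₂ : D₂ ≤ d) (h₂ : P₂ = [] → D₂ = 0) (h₂' : P₂ ≠ [] → D₂ + 1 ≤ P₂.length)
    (hD₃ : D₃ ≤ d) (h₃ : P₃ = [] → D₃ = 0) (h₃' : P₃ ≠ [] → D₃ + 1 ≤ P₃.length)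
    (e₁ : (G.neighborFinset b₁ \ C).card ≤ D₁) (e₂ : (G.neighborFinset b₂ \ C).card ≤ D₂)
    (e₃ : (G.neighborFinset b₃ \ C).card ≤ D₃) : 3 * s ≤ 2 * c := by
  have q₁ := h.sum_excess_le hD₁ h₁ h₁'
  have q₂ := h.rotate.sum_excess_le hD₂ h₂ h₂'
  have q₃ := h.rotate.rotate.sum_excess_le hD₃ h₃ h₃'
  simp only [excess_rotate] at q₁ q₂ q₃
  have hnd : (S₁ ++ S₂ ++ S₃).Nodup := nodup_of_count_le (fun a => by
    simp only [List.count_append]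
    omega) h.nodup
  have hCe : C = (S₁ ++ S₂ ++ S₃).toFinset := by
    ext v
    rw [hC, List.mem_toFinset]
  have hsum := sum_excess_eq (G := G) _ hnd b₁ b₂ b₃
  rw [← hCe] at hsum
  simp only [List.map_append, List.sum_append, List.length_append] at hsum
  have u₁ := (hs _ _ h.ends_ne h.not_adj_ends).trans (card_union_le_inter e₁ e₂)
  have u₂ := (hs _ _ h.rotate.ends_ne h.rotate.not_adj_ends).trans (card_union_le_inter e₂ e₃)
  have u₃ := (hs _ _ h.rotate.rotate.ends_ne.symm fun e => h.rotate.rotate.not_adj_ends e.symm).trans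
    (card_union_le_inter e₁ e₃)
  have := h.length_eq
  split_ifs at q₁ q₂ q₃ <;> omega

end RolesCount

section ComponentExistence

variable {V : Type*} {G : SimpleGraph V}

lemma LWalk.mem_of_closed {X F : Finset V} (hX : ∀ v ∈ X, ∀ w, G.Adj v w → w ∈ F → w ∈ X) :
    ∀ {l : List V} {u v : V}, LWalk G l u v → (∀ x ∈ l, x ∈ F) → u ∈ X → v ∈ X := by
  intro l
  induction l with
  | nil => exact fun h => absurd rfl h.ne_nil
  | cons a t ih =>
    intro u v h hF hu
    have ha := h.2.1
    simp only [List.head?_cons, Option.some_inj] at ha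
    subst ha
    cases t with
    | nil =>
      have := h.2.2
      simp only [List.getLast?_singleton, Option.some_inj] at this
      exact this ▸ hu
    | cons b t =>
      refine ih (LWalk.split (X := []) h).2 (fun x hx => hF x (by simp [hx])) (hX a hu b ?_ ?_)
      · exact (List.isChain_cons_cons.1 h.1).1
      · exact hF b (by simp)

lemma exists_isComp [Fintype V] {C : Finset V} {z : V} (hz : z ∉ C) :
    ∃ K, IsComp G C K ∧ z ∈ K := by
  classical
  have hzC : z ∈ Cᶜ := by simpa using hz
  refine ⟨Finset.univ.filter fun v => LongPath G Cᶜ z v 1, ⟨⟨z, ?_⟩, ?_, ?_, ?_⟩, ?_⟩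
  · simpa using LongPath.single hzC
  · rw [Finset.disjoint_left]
    intro v hv
    rw [Finset.mem_filter] at hv
    simpa using hv.2.symm.left_mem
  · intro v hv w hvw hw
    rw [Finset.mem_filter] at hv ⊢
    exact ⟨Finset.mem_univ w, hv.2.extend hvw (by simpa using hw)⟩
  · rintro X hX ⟨x, hx⟩ hne
    by_contra hbd
    rw [Finset.not_nonempty_iff_eq_empty, Finset.eq_empty_iff_forall_notMem] at hbd
    have hcl : ∀ v ∈ X, ∀ w, G.Adj v w → w ∈ Cᶜ → w ∈ X := by
      intro v hv w hvw hw
      by_contra hwX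
      refine hbd w (mem_bd.2 ⟨?_, hwX, v, hv, hvw⟩)
      have := hX hv
      rw [Finset.mem_filter] at this ⊢
      exact ⟨Finset.mem_univ w, this.2.extend hvw hw⟩
    have hzX : z ∈ X := by
      have := hX hx
      rw [Finset.mem_filter] at this
      obtain ⟨l, h1, -, h3, -⟩ := this.2.symm
      exact h1.mem_of_closed hcl h3 hx
    refine hne (Finset.Subset.antisymm hX fun y hy => ?_)
    rw [Finset.mem_filter] at hy
    obtain ⟨l, h1, -, h3, -⟩ := hy.2
    exact h1.mem_of_closed hcl h3 hzX
  · simpa using LongPath.single hzC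

lemma IsComp.subset_of_mem {C H K : Finset V} (hH : IsComp G C H) (hK : IsComp G C K) {z : V}
    (hz : z ∈ H) (hzK : z ∈ K) : H ⊆ K := by
  intro v hv
  obtain ⟨l, h1, -, h3, -⟩ := hH.longPath hz hv
  exact h1.mem_of_closed
    (fun a ha w haw hw => hK.closed a ha w haw (Finset.disjoint_left.1 hH.disj hw)) h3 hzK

lemma IsComp.eq_of_mem {C H K : Finset V} (hH : IsComp G C H) (hK : IsComp G C K) {z : V}
    (hz : z ∈ H) (hzK : z ∈ K) : H = K :=
  (hH.subset_of_mem hK hz hzK).antisymm (hK.subset_of_mem hH hzK hz)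

lemma IsComp.disjoint {C H K : Finset V} (hH : IsComp G C H) (hK : IsComp G C K) (hne : H ≠ K) :
    Disjoint H K :=
  Finset.disjoint_left.2 fun _ h1 h2 => hne (hH.eq_of_mem hK h1 h2)

lemma IsComp.link {C H : Finset V} (hH : IsComp G C H) {x y : V} (hx : ∃ u ∈ H, G.Adj u x)
    (hy : ∃ u ∈ H, G.Adj u y) : Link G H x y 1 := by
  obtain ⟨u, hu, hux⟩ := hx
  obtain ⟨w, hw, hwy⟩ := hy
  exact ⟨u, w, hux.symm, hwy, hH.longPath hu hw⟩

lemma Link.left_attached {H : Finset V} {x y : V} {m : ℕ} (h : Link G H x y m) :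
    ∃ u ∈ H, G.Adj u x := by
  obtain ⟨u, w, h1, -, h3⟩ := h
  exact ⟨u, h3.left_mem, h1.symm⟩

end ComponentExistence

section CycleSurgery

variable {V : Type*} {G : SimpleGraph V}

/-- A longest cycle, given as a list. -/
structure LongestCycle (G : SimpleGraph V) (l : List V) : Prop where
  cycle : LCycle G l
  le : ∀ l', LCycle G l' → l'.length ≤ l.length

lemma LWalk.split_of_ne_nil {X Y : List V} {u v z : V} (h : LWalk G (X ++ v :: Y) u z)
    (hY : Y ≠ []) : ∃ w, G.Adj v w ∧ LWalk G (X ++ [v]) u v ∧ LWalk G Y w z := by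
  cases Y with
  | nil => exact absurd rfl hY
  | cons w Y =>
    exact ⟨w, (List.isChain_cons_cons.1 h.splitAt.2.1).1, h.split.1, h.split.2⟩

lemma LWalk.adj_of_append {X Y : List V} {u z v w v' u' : V} (h : LWalk G (X ++ Y) u z)
    (hX : LWalk G X u' v) (hY : LWalk G Y w v') : G.Adj v w := by
  have := (List.isChain_append.1 h.1).2.2
  exact this v (by simp [hX.2.2]) w (by simp [hY.2.1])

lemma LCycle.rotate {A B : List V} (h : LCycle G (A ++ B)) : LCycle G (B ++ A) := by
  by_cases hA : A = []
  · subst hA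
    simpa using h
  by_cases hB : B = []
  · subst hB
    simpa using h
  obtain ⟨hn, u, v, hw, hvu⟩ := h
  obtain ⟨a, ha⟩ := hw.of_append_left hA
  obtain ⟨b, hb⟩ := hw.of_append_right hB
  exact ⟨List.nodup_append_comm.1 hn, b, a, hb.append ha hvu, hw.adj_of_append ha hb⟩

lemma LongestCycle.not_link {l : List V} (hl : LongestCycle G l) {l' : List V} {u v : V}
    (hp : l'.Perm l) (hw : LWalk G l' u v) {H : Finset V} (hH : ∀ x ∈ l, x ∉ H) :
    ¬ Link G H u v 1 := by
  rintro h
  obtain ⟨a, b, h1, h2, L, hL, hL1, hL2, hL3⟩ := h.symm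
  have := hl.le (l' ++ L) ⟨?_, u, b, hw.append hL h1, h2⟩
  · have := hp.length_eq
    simp only [List.length_append] at *
    omega
  · rw [List.nodup_append']
    exact ⟨hp.nodup_iff.2 hl.cycle.1, hL1, fun x hx hx' => hH x (hp.mem_iff.1 hx) (hL2 x hx')⟩

lemma LongestCycle.not_links {l : List V} (hl : LongestCycle G l) {U W : List V} {u v w z : V}
    (hp : (U ++ W).Perm l) (hU : LWalk G U u v) (hW : LWalk G W w z) {H K : Finset V}
    (hH : ∀ x ∈ l, x ∉ H) (hK : ∀ x ∈ l, x ∉ K) (hHK : Disjoint H K) (h : Link G H v z 1)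
    (h' : Link G K u w 1) : False := by
  obtain ⟨a, b, h1, h2, L, hL, hL1, hL2, hL3⟩ := h
  obtain ⟨a', b', h1', h2', L', hL', hL1', hL2', hL3'⟩ := h'.symm
  have := hl.le (((U ++ L) ++ W.reverse) ++ L') ⟨?_, u, b',
    ((hU.append hL h1).append hW.reverse h2).append hL' h1', h2'⟩
  · have := hp.length_eq
    simp only [List.length_append, List.length_reverse] at *
    omega
  · have hn := hp.nodup_iff.2 hl.cycle.1
    have hm : ∀ x, x ∈ U ∨ x ∈ W → x ∈ l := fun x hx => hp.mem_iff.1 (List.mem_append.2 hx)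
    have e1 : ∀ x, x ∈ L → x ∉ L' := fun x h1 h2 =>
      Finset.disjoint_left.1 hHK (hL2 x h1) (hL2' x h2)
    have e2 : ∀ x ∈ l, x ∉ L := fun x h1 h2 => hH x h1 (hL2 x h2)
    have e3 : ∀ x ∈ l, x ∉ L' := fun x h1 h2 => hK x h1 (hL2' x h2)
    simp only [List.nodup_append', List.nodup_reverse, List.disjoint_left, List.mem_append,
      List.mem_reverse] at hn ⊢
    refine ⟨⟨⟨hn.1, hL1, ?_⟩, hn.2.1, ?_⟩, hL1', ?_⟩
    · exact fun x hx => e2 x (hm x (Or.inl hx))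
    · rintro x (hx | hx) hx'
      · exact hn.2.2 hx hx'
      · exact e2 x (hm x (Or.inr hx')) hx
    · rintro x ((hx | hx) | hx) hx'
      · exact e3 x (hm x (Or.inl hx)) hx'
      · exact e1 x hx hx'
      · exact e3 x (hm x (Or.inr hx)) hx'

end CycleSurgery

section Frame

variable {V : Type*} {G : SimpleGraph V}

/-- A cyclic list cut into three consecutive segments ending in `x₂, x₃, x₁`. -/
structure Frame (G : SimpleGraph V) (l S₁ S₂ S₃ : List V) (x₁ x₂ x₃ a₁ a₂ a₃ : V) : Prop where
  perm : (S₁ ++ S₂ ++ S₃).Perm l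
  walk₁ : LWalk G S₁ a₁ x₂
  walk₂ : LWalk G S₂ a₂ x₃
  walk₃ : LWalk G S₃ a₃ x₁
  adj₁ : G.Adj x₁ a₁
  adj₂ : G.Adj x₂ a₂
  adj₃ : G.Adj x₃ a₃

lemma Frame.rotate {l S₁ S₂ S₃ : List V} {x₁ x₂ x₃ a₁ a₂ a₃ : V}
    (h : Frame G l S₁ S₂ S₃ x₁ x₂ x₃ a₁ a₂ a₃) : Frame G l S₂ S₃ S₁ x₂ x₃ x₁ a₂ a₃ a₁ := by
  refine ⟨?_, h.walk₂, h.walk₃, h.walk₁, h.adj₂, h.adj₃, h.adj₁⟩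
  refine List.Perm.trans ?_ h.perm
  rw [List.append_assoc S₁]
  exact List.perm_append_comm

lemma LCycle.exists_concat {l : List V} (h : LCycle G l) {x : V} (hx : x ∈ l) :
    ∃ T a, (T ++ [x]) ~r l ∧ LWalk G (T ++ [x]) a x ∧ G.Adj x a := by
  obtain ⟨A, B, rfl⟩ := List.append_of_mem hx
  have h' : LCycle G (B ++ (A ++ [x])) := by
    apply LCycle.rotate
    simpa using h
  obtain ⟨-, u, v, hw, hvu⟩ := h'
  have hv : x = v := by
    have := hw.2.2
    simpa using this
  subst hv
  refine ⟨B ++ A, u, ?_, by simpa using hw, hvu⟩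
  have : (B ++ (A ++ [x])) ~r ((A ++ [x]) ++ B) := List.isRotated_append
  simpa using this

lemma exists_frame_of_split {l X Z W : List V} {a x₁ x₂ x₃ : V}
    (hp : ((X ++ x₂ :: (Z ++ x₃ :: W)) ++ [x₁]).Perm l)
    (hw : LWalk G ((X ++ x₂ :: (Z ++ x₃ :: W)) ++ [x₁]) a x₁) (ha : G.Adj x₁ a) :
    ∃ S₁ S₂ S₃ a₂ a₃, Frame G l S₁ S₂ S₃ x₁ x₂ x₃ a a₂ a₃ := by
  have e : (X ++ x₂ :: (Z ++ x₃ :: W)) ++ [x₁] = X ++ x₂ :: (Z ++ x₃ :: (W ++ [x₁])) := by simp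
  rw [e] at hp hw
  obtain ⟨a₂, h1, h2, h3⟩ := hw.split_of_ne_nil (by simp)
  obtain ⟨a₃, h4, h5, h6⟩ := h3.split_of_ne_nil (by simp)
  refine ⟨X ++ [x₂], Z ++ [x₃], W ++ [x₁], a₂, a₃, ?_, h2, h5, h6, ha, h1, h4⟩
  simpa using hp

lemma LCycle.exists_frame {l : List V} (h : LCycle G l) {x₁ x₂ x₃ : V} (h₁ : x₁ ∈ l) (h₂ : x₂ ∈ l)
    (h₃ : x₃ ∈ l) (h₁₂ : x₁ ≠ x₂) (h₁₃ : x₁ ≠ x₃) (h₂₃ : x₂ ≠ x₃) :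
    (∃ S₁ S₂ S₃ a₁ a₂ a₃, Frame G l S₁ S₂ S₃ x₁ x₂ x₃ a₁ a₂ a₃) ∨
      ∃ S₁ S₂ S₃ a₁ a₂ a₃, Frame G l S₁ S₂ S₃ x₁ x₃ x₂ a₁ a₂ a₃ := by
  obtain ⟨T, a, hr, hw, ha⟩ := h.exists_concat h₁
  have hp := hr.perm
  have m₂ : x₂ ∈ T := by simpa [h₁₂.symm] using hp.mem_iff.2 h₂
  have m₃ : x₃ ∈ T := by simpa [h₁₃.symm] using hp.mem_iff.2 h₃
  obtain ⟨X, Y, rfl⟩ := List.append_of_mem m₂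
  have m₃' : x₃ ∈ X ∨ x₃ ∈ Y := by simpa [h₂₃.symm] using m₃
  rcases m₃' with hX | hY
  · obtain ⟨Z, W, rfl⟩ := List.append_of_mem hX
    right
    rw [List.append_assoc Z, List.cons_append] at hp hw
    obtain ⟨S₁, S₂, S₃, a₂, a₃, hF⟩ := exists_frame_of_split hp hw ha
    exact ⟨S₁, S₂, S₃, a, a₂, a₃, hF⟩
  · obtain ⟨Z, W, rfl⟩ := List.append_of_mem hY
    left
    obtain ⟨S₁, S₂, S₃, a₂, a₃, hF⟩ := exists_frame_of_split hp hw ha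
    exact ⟨S₁, S₂, S₃, a, a₂, a₃, hF⟩

lemma Frame.not_attached {l S₁ S₂ S₃ : List V} {x₁ x₂ x₃ a₁ a₂ a₃ : V} {C H : Finset V}
    (hF : Frame G l S₁ S₂ S₃ x₁ x₂ x₃ a₁ a₂ a₃) (hl : LongestCycle G l)
    (hlC : ∀ v, v ∈ C ↔ v ∈ l) (hH : IsComp G C H) (hx : ∃ u ∈ H, G.Adj u x₁) :
    ¬ ∃ u ∈ H, G.Adj u a₁ := by
  intro h
  exact hl.not_link hF.perm ((hF.walk₁.append hF.walk₂ hF.adj₂).append hF.walk₃ hF.adj₃)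
    (fun x hx hxH => Finset.disjoint_left.1 hH.disj hxH ((hlC x).2 hx)) (hH.link h hx)

end Frame

section Legs

variable {V : Type*} {G : SimpleGraph V}

lemma card_le_degIn {F S : Finset V} {w : V} (h : ∀ v ∈ S, v ∈ F ∧ G.Adj w v) :
    S.card ≤ degIn G F w := by
  classical
  exact Finset.card_le_card fun v hv => Finset.mem_filter.2 (h v hv)

variable [Fintype V] [DecidableEq V] [DecidableRel G.Adj]

/-- A path `P` from `a` to `b` inside a component `K` (or an empty path) such that `b` has at most
`D ≤ d` neighbours outside `C`. -/
structure Leg (G : SimpleGraph V) [DecidableRel G.Adj] (C : Finset V) (d : ℕ) (a : V) (P : List V)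
    (b : V) (D : ℕ) (K : Finset V) : Prop where
  walk : LWalk G (a :: P) a b
  nodup : P.Nodup
  mem : ∀ v ∈ P, v ∈ K
  le : D ≤ d
  eq_zero : P = [] → D = 0
  succ_le : P ≠ [] → D + 1 ≤ P.length
  card_le : (G.neighborFinset b \ C).card ≤ D
  comp : P = [] ∨ (IsComp G C K ∧ ∃ u ∈ K, G.Adj u a)

lemma exists_leg {C H : Finset V} (hG : ThreeConn G) (hC : 3 ≤ C.card) {d : ℕ}
    (hmax : ∀ K k, IsComp G C K → Triple G C K k → k ≤ d + 1)
    (hspec : ∀ K, IsComp G C K → IsSpecial G C K → K ≠ H → 1 ≤ d) {a : V}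
    (haH : ¬ ∃ u ∈ H, G.Adj u a) : ∃ P b D K, Leg G C d a P b D K := by
  by_cases hz : ∃ z, z ∉ C ∧ G.Adj a z
  · obtain ⟨z, hzC, haz⟩ := hz
    obtain ⟨K, hK, hzK⟩ := exists_isComp (G := G) hzC
    have hKH : K ≠ H := by
      rintro rfl
      exact haH ⟨z, hzK, haz.symm⟩
    obtain ⟨b, hb, ⟨P, h1, h2, h3, h4⟩, h5⟩ := hK.exists_end hG hC hzK
    refine ⟨P, b, degIn G K b, K, h1.cons haz, h2, h3, ?_, ?_, fun _ => h4, ?_,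
      Or.inr ⟨hK, z, hzK, haz.symm⟩⟩
    · rcases h5 with h5 | ⟨h5, h6⟩
      · have := hmax K _ hK h5
        omega
      · have := hspec K hK h5 hKH
        omega
    · intro h
      exact absurd h h1.ne_nil
    · refine card_le_degIn fun v hv => ?_
      rw [Finset.mem_sdiff, SimpleGraph.mem_neighborFinset] at hv
      exact ⟨hK.closed b hb v hv.1 hv.2, hv.1⟩
  · push Not at hz
    refine ⟨[], a, 0, ∅, LWalk.single a, List.nodup_nil, by simp, Nat.zero_le _, fun _ => rfl,
      fun h => absurd rfl h, ?_, Or.inl rfl⟩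
    rw [Nat.le_zero, Finset.card_eq_zero, Finset.sdiff_eq_empty_iff_subset]
    intro v hv
    rw [SimpleGraph.mem_neighborFinset] at hv
    by_contra h
    exact hz v h hv

variable {l S₁ S₂ S₃ P₁ P₂ : List V} {x₁ x₂ x₃ a₁ a₂ a₃ b₁ b₂ : V} {C H K₁ K₂ : Finset V}
  {d D₁ D₂ : ℕ}

lemma Frame.disjoint_legs (hF : Frame G l S₁ S₂ S₃ x₁ x₂ x₃ a₁ a₂ a₃) (hl : LongestCycle G l)
    (hlC : ∀ v, v ∈ C ↔ v ∈ l) (hH : IsComp G C H) (hx₁ : ∃ u ∈ H, G.Adj u x₁)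
    (hx₂ : ∃ u ∈ H, G.Adj u x₂) (h₁ : Leg G C d a₁ P₁ b₁ D₁ K₁) (h₂ : Leg G C d a₂ P₂ b₂ D₂ K₂) :
    P₁.Disjoint P₂ := by
  rcases h₁.comp with rfl | ⟨hK₁, hu₁⟩
  · simp
  rcases h₂.comp with rfl | ⟨hK₂, hu₂⟩
  · simp
  intro v hv₁ hv₂
  have hout : ∀ K, IsComp G C K → ∀ x ∈ l, x ∉ K := fun K hK x hx hxK =>
    Finset.disjoint_left.1 hK.disj hxK ((hlC x).2 hx)
  obtain rfl := hK₁.eq_of_mem hK₂ (h₁.mem v hv₁) (h₂.mem v hv₂)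
  have hne : H ≠ K₁ := by
    rintro rfl
    exact hF.not_attached hl hlC hH hx₁ hu₁
  refine hl.not_links (U := S₁) (W := S₂ ++ S₃) ?_ hF.walk₁ (hF.walk₂.append hF.walk₃ hF.adj₃)
    (hout H hH) (hout K₁ hK₁) (hH.disjoint hK₁ hne) (hH.link hx₂ hx₁) (hK₁.link hu₁ hu₂)
  rw [← List.append_assoc]
  exact hF.perm

lemma Frame.three_mul_le (hF : Frame G l S₁ S₂ S₃ x₁ x₂ x₃ a₁ a₂ a₃) (hl : LongestCycle G l)
    (hlC : ∀ v, v ∈ C ↔ v ∈ l) (hG : ThreeConn G) (hC : 3 ≤ C.card) (hH : IsComp G C H)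
    (l₁₂ : Link G H x₁ x₂ (d + 1)) (l₂₃ : Link G H x₂ x₃ (d + 1)) (l₃₁ : Link G H x₃ x₁ (d + 1))
    (hmax : ∀ K k, IsComp G C K → Triple G C K k → k ≤ d + 1)
    (hspec : ∀ K, IsComp G C K → IsSpecial G C K → K ≠ H → 1 ≤ d) {s : ℕ}
    (hs : ∀ u v : V, u ≠ v → ¬ G.Adj u v →
      s ≤ (G.neighborFinset u ∪ G.neighborFinset v).card) : 3 * s ≤ 2 * l.length := by
  have t₁ := l₁₂.left_attached
  have t₂ := l₂₃.left_attached
  have t₃ := l₃₁.left_attached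
  have n₁ := hF.not_attached hl hlC hH t₁
  have n₂ := hF.rotate.not_attached hl hlC hH t₂
  have n₃ := hF.rotate.rotate.not_attached hl hlC hH t₃
  obtain ⟨P₁, b₁, D₁, K₁, g₁⟩ := exists_leg hG hC hmax hspec n₁
  obtain ⟨P₂, b₂, D₂, K₂, g₂⟩ := exists_leg hG hC hmax hspec n₂
  obtain ⟨P₃, b₃, D₃, K₃, g₃⟩ := exists_leg hG hC hmax hspec n₃
  have dj₁₂ := hF.disjoint_legs hl hlC hH t₁ t₂ g₁ g₂
  have dj₂₃ := hF.rotate.disjoint_legs hl hlC hH t₂ t₃ g₂ g₃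
  have dj₃₁ := hF.rotate.rotate.disjoint_legs hl hlC hH t₃ t₁ g₃ g₁
  have hmem : ∀ v, v ∈ C ↔ v ∈ S₁ ++ S₂ ++ S₃ := fun v => (hlC v).trans hF.perm.mem_iff.symm
  have hleg : ∀ {a P b D K}, Leg G C d a P b D K → (¬ ∃ u ∈ H, G.Adj u a) →
      ∀ v ∈ P, v ∉ C ∧ v ∉ H := by
    intro a P b D K g hn v hv
    rcases g.comp with rfl | ⟨hK, hu⟩
    · simp at hv
    · refine ⟨Finset.disjoint_left.1 hK.disj (g.mem v hv), fun hvH => hn ?_⟩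
      rwa [hH.eq_of_mem hK hvH (g.mem v hv)]
  have f₁ := hleg g₁ n₁
  have f₂ := hleg g₂ n₂
  have f₃ := hleg g₃ n₃
  have hR : Roles G l.length d H S₁ S₂ S₃ P₁ P₂ P₃ x₁ x₂ x₃ a₁ a₂ a₃ b₁ b₂ b₃ := by
    refine ⟨hF.walk₁, hF.walk₂, hF.walk₃, hF.adj₁, hF.adj₂, hF.adj₃, l₁₂, l₂₃, l₃₁, g₁.walk,
      g₂.walk, g₃.walk, ?_, ?_, ?_, hl.le⟩
    · rw [List.nodup_append', List.nodup_append', List.nodup_append']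
      refine ⟨⟨⟨hF.perm.nodup_iff.2 hl.cycle.1, g₁.nodup, ?_⟩, g₂.nodup, ?_⟩, g₃.nodup, ?_⟩
      · exact fun v h h' => (f₁ v h').1 ((hmem v).2 h)
      · rw [List.disjoint_append_left]
        exact ⟨fun v h h' => (f₂ v h').1 ((hmem v).2 h), dj₁₂⟩
      · rw [List.disjoint_append_left, List.disjoint_append_left]
        exact ⟨⟨fun v h h' => (f₃ v h').1 ((hmem v).2 h), dj₃₁.symm⟩, dj₂₃⟩
    · intro v hv
      rw [List.mem_append, List.mem_append, List.mem_append, ← hmem] at hv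
      rcases hv with ((hv | hv) | hv) | hv
      · exact fun h => Finset.disjoint_left.1 hH.disj h hv
      · exact (f₁ v hv).2
      · exact (f₂ v hv).2
      · exact (f₃ v hv).2
    · have := hF.perm.length_eq
      simp only [List.length_append] at this
      omega
  exact hR.three_mul_le hs hmem g₁.le g₁.eq_zero g₁.succ_le g₂.le g₂.eq_zero g₂.succ_le g₃.le
    g₃.eq_zero g₃.succ_le g₁.card_le g₂.card_le g₃.card_le

lemma LongestCycle.three_mul_le_of_triple (hl : LongestCycle G l) (hlC : ∀ v, v ∈ C ↔ v ∈ l)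
    (hG : ThreeConn G) (hC : 3 ≤ C.card) (hH : IsComp G C H) (hT : Triple G C H (d + 1))
    (hmax : ∀ K k, IsComp G C K → Triple G C K k → k ≤ d + 1)
    (hspec : ∀ K, IsComp G C K → IsSpecial G C K → K ≠ H → 1 ≤ d) {s : ℕ}
    (hs : ∀ u v : V, u ≠ v → ¬ G.Adj u v →
      s ≤ (G.neighborFinset u ∪ G.neighborFinset v).card) : 3 * s ≤ 2 * l.length := by
  obtain ⟨x₁, m₁, x₂, m₂, x₃, m₃, n₁₂, n₁₃, n₂₃, l₁₂, l₁₃, l₂₃⟩ := hT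
  rcases hl.cycle.exists_frame ((hlC _).1 m₁) ((hlC _).1 m₂) ((hlC _).1 m₃) n₁₂ n₁₃ n₂₃ with
    ⟨S₁, S₂, S₃, a₁, a₂, a₃, hF⟩ | ⟨S₁, S₂, S₃, a₁, a₂, a₃, hF⟩
  · exact hF.three_mul_le hl hlC hG hC hH l₁₂ l₂₃ l₁₃.symm hmax hspec hs
  · exact hF.three_mul_le hl hlC hG hC hH l₁₃ l₂₃.symm l₁₂.symm hmax hspec hs

end Legs

section SpecialComponents

variable {V : Type*} {G : SimpleGraph V} [DecidableEq V]

lemma LCycle.exists_concat_formPerm {l : List V} (h : LCycle G l) {x : V} (hx : x ∈ l) :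
    ∃ T, (T ++ [x]) ~r l ∧ LWalk G (T ++ [x]) (l.formPerm x) x := by
  obtain ⟨T, a, hr, hw, -⟩ := h.exists_concat hx
  refine ⟨T, hr, ?_⟩
  have e : l.formPerm x = a := by
    rw [← List.formPerm_eq_of_isRotated (hr.perm.nodup_iff.2 h.1) hr]
    have hl := hw.2.2
    obtain ⟨t, ht⟩ := hw.exists_cons
    rw [ht] at hl ⊢
    rw [List.getLast?_eq_some_getLast (by simp), Option.some_inj] at hl
    have := List.formPerm_apply_getLast a t
    rwa [hl] at this
  rwa [e]

lemma LCycle.exists_split_formPerm {l : List V} (h : LCycle G l) {x y : V} (hx : x ∈ l)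
    (hy : y ∈ l) (hxy : x ≠ y) : ∃ U W, (U ++ W).Perm l ∧ LWalk G U (l.formPerm x) y ∧
      LWalk G W (l.formPerm y) x := by
  obtain ⟨T, hr, hw⟩ := h.exists_concat_formPerm hx
  have m : y ∈ T := by simpa [hxy.symm] using hr.perm.mem_iff.2 hy
  obtain ⟨X, Y, rfl⟩ := List.append_of_mem m
  rw [List.append_assoc, List.cons_append] at hr hw
  obtain ⟨w, h1, h2, h3⟩ := hw.split_of_ne_nil (by simp)
  have hn := hr.perm.nodup_iff.2 h.1
  have e : l.formPerm y = w := by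
    obtain ⟨t, ht⟩ := h3.exists_cons
    rw [ht] at hr hn
    have hr' : (X ++ y :: w :: t) ~r (y :: w :: (t ++ X)) := by
      simpa using List.isRotated_append (l := X) (l' := y :: w :: t)
    rw [← List.formPerm_eq_of_isRotated hn hr, List.formPerm_eq_of_isRotated hn hr']
    exact List.formPerm_apply_head _ _ _ (hr'.perm.nodup_iff.1 hn)
  refine ⟨X ++ [y], Y ++ [x], ?_, h2, e ▸ h3⟩
  simpa using hr.perm

lemma LongestCycle.formPerm_notMem_attach {l : List V} (hl : LongestCycle G l) {C H : Finset V}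
    (hlC : ∀ v, v ∈ C ↔ v ∈ l) (hH : IsComp G C H) {x : V} (hx : x ∈ attach G C H) :
    l.formPerm x ∉ attach G C H := by
  intro h
  rw [mem_attach] at hx h
  obtain ⟨T, hr, hw⟩ := hl.cycle.exists_concat_formPerm ((hlC x).1 hx.1)
  exact hl.not_link hr.perm hw
    (fun x hx hxH => Finset.disjoint_left.1 hH.disj hxH ((hlC x).2 hx)) (hH.link h.2 hx.2)

lemma LongestCycle.card_crossing_le_one {l : List V} (hl : LongestCycle G l) {C H K : Finset V}
    (hlC : ∀ v, v ∈ C ↔ v ∈ l) (hH : IsComp G C H) (hK : IsComp G C K) (hHK : H ≠ K) :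
    ((attach G C H).filter fun x => l.formPerm x ∈ attach G C K).card ≤ 1 := by
  rw [Finset.card_le_one]
  intro x hx y hy
  by_contra hxy
  simp only [Finset.mem_filter, mem_attach] at hx hy
  obtain ⟨U, W, hp, hU, hW⟩ := hl.cycle.exists_split_formPerm ((hlC x).1 hx.1.1)
    ((hlC y).1 hy.1.1) hxy
  exact hl.not_links hp hU hW
    (fun x hx hxH => Finset.disjoint_left.1 hH.disj hxH ((hlC x).2 hx))
    (fun x hx hxH => Finset.disjoint_left.1 hK.disj hxH ((hlC x).2 hx)) (hH.disjoint hK hHK)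
    (hH.link hy.1.2 hx.1.2) (hK.link hx.2.2 hy.2.2)

lemma card_add_card_le_of_image {C B : Finset V} {σ : Equiv.Perm V} (hB : B ⊆ C)
    (hσ : ∀ x ∈ C, σ x ∈ C) {k : ℕ} (hk : (B.filter fun x => σ x ∈ B).card ≤ k) :
    2 * B.card ≤ C.card + k := by
  have h1 : ((B.filter fun x => ¬ σ x ∈ B).image σ) ⊆ C \ B := by
    intro y hy
    rw [Finset.mem_image] at hy
    obtain ⟨x, hx, rfl⟩ := hy
    rw [Finset.mem_filter] at hx
    exact Finset.mem_sdiff.2 ⟨hσ x (hB hx.1), hx.2⟩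
  have h2 := Finset.card_le_card h1
  rw [Finset.card_image_of_injective _ σ.injective, Finset.card_sdiff_of_subset hB] at h2
  have h3 := Finset.card_filter_add_card_filter_not (s := B) fun x => σ x ∈ B
  have h4 := Finset.card_le_card hB
  omega

lemma sum_card_union_le {A₁ A₂ A₁' A₂' : Finset V} (hA : Disjoint A₁ A₂)
    (hA' : Disjoint A₁' A₂') : (A₁ ∪ A₁').card + (A₁ ∪ A₂').card + (A₂ ∪ A₁').card +
      (A₂ ∪ A₂').card ≤ 3 * ((A₁ ∪ A₂) ∪ (A₁' ∪ A₂')).card := by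
  set B := (A₁ ∪ A₂) ∪ (A₁' ∪ A₂') with hB
  have key : ∀ S ⊆ B, S.card = ∑ x ∈ B, if x ∈ S then 1 else 0 := by
    intro S hS
    rw [Finset.sum_ite_mem, Finset.inter_eq_right.2 hS, Finset.card_eq_sum_ones]
  rw [key (A₁ ∪ A₁') (by grind), key (A₁ ∪ A₂') (by grind), key (A₂ ∪ A₁') (by grind),
    key (A₂ ∪ A₂') (by grind), ← Finset.sum_add_distrib, ← Finset.sum_add_distrib,
    ← Finset.sum_add_distrib, mul_comm, ← smul_eq_mul, ← Finset.sum_const]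
  refine Finset.sum_le_sum fun x _ => ?_
  have h1 : x ∈ A₁ → x ∉ A₂ := fun h => Finset.disjoint_left.1 hA h
  have h2 : x ∈ A₁' → x ∉ A₂' := fun h => Finset.disjoint_left.1 hA' h
  simp only [Finset.mem_union]
  by_cases a1 : x ∈ A₁ <;> by_cases a2 : x ∈ A₂ <;> by_cases a3 : x ∈ A₁' <;>
    by_cases a4 : x ∈ A₂' <;> simp_all

lemma attach_pair {C H : Finset V} {u u' : V} (hu : ∀ v, v ∈ H ↔ v = u ∨ v = u') :
    attach G C H = attach G C {u} ∪ attach G C {u'} := by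
  ext x
  simp only [mem_attach, Finset.mem_union, Finset.mem_singleton, hu]
  grind

variable [Fintype V] [DecidableRel G.Adj]

lemma neighborFinset_subset_of_pair {C H : Finset V} (hH : IsComp G C H) {u u' : V}
    (hu : ∀ v, v ∈ H ↔ v = u ∨ v = u') :
    G.neighborFinset u ⊆ insert u' (attach G C {u}) := by
  intro v hv
  rw [SimpleGraph.mem_neighborFinset] at hv
  by_cases hvC : v ∈ C
  · exact Finset.mem_insert_of_mem (mem_attach.2 ⟨hvC, u, by simp, hv⟩)
  · rcases (hu v).1 (hH.closed u ((hu u).2 (Or.inl rfl)) v hv hvC) with rfl | rfl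
    · exact absurd hv (G.loopless.irrefl _)
    · exact Finset.mem_insert_self _ _

lemma card_union_le_of_pairs {C H K : Finset V} (hH : IsComp G C H) (hK : IsComp G C K)
    (hHK : Disjoint H K) {u u' w w' : V}
    (hu : ∀ v, v ∈ H ↔ v = u ∨ v = u') (hw : ∀ v, v ∈ K ↔ v = w ∨ v = w') {s : ℕ}
    (hs : ∀ u v : V, u ≠ v → ¬ G.Adj u v →
      s ≤ (G.neighborFinset u ∪ G.neighborFinset v).card) :
    s ≤ (attach G C {u} ∪ attach G C {w}).card + 2 := by
  have huH : u ∈ H := (hu u).2 (Or.inl rfl)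
  have hwK : w ∈ K := (hw w).2 (Or.inl rfl)
  have h1 := hs u w (fun e => Finset.disjoint_left.1 hHK huH (e ▸ hwK))
    fun e => Finset.disjoint_left.1 hHK
      (hH.closed u huH w e (Finset.disjoint_left.1 hK.disj hwK)) hwK
  refine h1.trans ((Finset.card_le_card (t := insert u' (insert w' (attach G C {u} ∪
    attach G C {w}))) ?_).trans ((Finset.card_insert_le _ _).trans
      (Nat.succ_le_succ (Finset.card_insert_le _ _))))
  have h2 := neighborFinset_subset_of_pair hH hu
  have h3 := neighborFinset_subset_of_pair hK hw
  grind

lemma LongestCycle.three_mul_le_of_special {l : List V} (hl : LongestCycle G l) {C H K : Finset V}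
    (hlC : ∀ v, v ∈ C ↔ v ∈ l) (hG : ThreeConn G) (hC : 3 ≤ C.card) (hH : IsComp G C H)
    (hK : IsComp G C K) (hHK : H ≠ K) (hH' : IsSpecial G C H) (hK' : IsSpecial G C K) {s : ℕ}
    (hs : ∀ u v : V, u ≠ v → ¬ G.Adj u v →
      s ≤ (G.neighborFinset u ∪ G.neighborFinset v).card) : 3 * s ≤ 2 * l.length := by
  obtain ⟨u, u', hne, hu, -, hdj⟩ := hH'
  obtain ⟨w, w', hne', hw, -, hdj'⟩ := hK'
  have hu' : ∀ v, v ∈ H ↔ v = u' ∨ v = u := fun v => (hu v).trans or_comm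
  have hw' : ∀ v, v ∈ K ↔ v = w' ∨ v = w := fun v => (hw v).trans or_comm
  have hd := hH.disjoint hK hHK
  have s₁ := card_union_le_of_pairs hH hK hd hu hw hs
  have s₂ := card_union_le_of_pairs hH hK hd hu hw' hs
  have s₃ := card_union_le_of_pairs hH hK hd hu' hw hs
  have s₄ := card_union_le_of_pairs hH hK hd hu' hw' hs
  have d₁ : Disjoint (attach G C {u}) (attach G C {u'}) := by
    simp only [Finset.disjoint_left, mem_attach, Finset.mem_singleton]
    grind
  have d₂ : Disjoint (attach G C {w}) (attach G C {w'}) := by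
    simp only [Finset.disjoint_left, mem_attach, Finset.mem_singleton]
    grind
  have hsum := sum_card_union_le d₁ d₂
  rw [← attach_pair hu, ← attach_pair hw] at hsum
  have hσ : ∀ x ∈ C, l.formPerm x ∈ C := fun x hx =>
    (hlC _).2 (List.formPerm_apply_mem_of_mem ((hlC x).1 hx))
  have hsub : ∀ X, attach G C X ⊆ C := fun X x hx => (mem_attach.1 hx).1
  have hA := card_add_card_le_of_image (σ := l.formPerm) (hsub H) hσ (k := 0) (by
    rw [Nat.le_zero, Finset.card_eq_zero, Finset.filter_eq_empty_iff]
    exact fun x hx => hl.formPerm_notMem_attach hlC hH hx)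
  have hB := card_add_card_le_of_image (σ := l.formPerm)
    (Finset.union_subset (hsub H) (hsub K)) hσ (k := 2) (by
      refine (Finset.card_le_card ?_).trans ((Finset.card_union_le _ _).trans
        (add_le_add (hl.card_crossing_le_one hlC hH hK hHK)
          (hl.card_crossing_le_one hlC hK hH hHK.symm)))
      intro x hx
      have h1 := hl.formPerm_notMem_attach hlC hH (x := x)
      have h2 := hl.formPerm_notMem_attach hlC hK (x := x)
      simp only [Finset.mem_filter, Finset.mem_union] at hx ⊢
      tauto)
  have c₁ := hH.two_le_attach_special hG hC hu hne
  have c₂ := hH.two_le_attach_special hG hC hu' hne.symm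
  have c₃ := congrArg Finset.card (attach_pair (G := G) (C := C) hu)
  rw [Finset.card_union_of_disjoint d₁] at c₃
  have hcard : C.card = l.length := by
    rw [← List.toFinset_card_of_nodup hl.cycle.1]
    congr 1
    ext v
    rw [hlC, List.mem_toFinset]
  omega

end SpecialComponents

section Cycles

variable {V : Type*} {G : SimpleGraph V}

lemma LWalk.exists_walk {l : List V} {u v : V} (h : LWalk G l u v) :
    ∃ p : G.Walk u v, p.support = l := by
  have hne := h.ne_nil
  have hh : l.head hne = u := by
    have := h.2.1
    rwa [List.head?_eq_some_head hne, Option.some_inj] at this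
  have hl : l.getLast hne = v := by
    have := h.2.2
    rwa [List.getLast?_eq_some_getLast hne, Option.some_inj] at this
  have hc := h.1
  clear h
  subst hh hl
  exact ⟨SimpleGraph.Walk.ofSupport l hne hc, SimpleGraph.Walk.support_ofSupport _ _⟩

lemma LCycle.hasCycleLength {l : List V} (h : LCycle G l) (hl : 3 ≤ l.length) :
    HasCycleLength G l.length := by
  obtain ⟨hn, u, v, hw, hvu⟩ := h
  obtain ⟨p, hp⟩ := hw.exists_walk
  have hlen := p.length_support
  rw [hp] at hlen
  have hpath : p.IsPath := SimpleGraph.Walk.IsPath.mk' (hp ▸ hn)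
  refine ⟨v, SimpleGraph.Walk.cons hvu p, ?_, by simp [hlen]⟩
  rw [SimpleGraph.Walk.cons_isCycle_iff]
  refine ⟨hpath, fun he => ?_⟩
  have := hpath.length_eq_one_of_mem_edges (Sym2.eq_swap ▸ he)
  omega

end Cycles

section Selection

variable {V : Type*} {G : SimpleGraph V} [Fintype V]

lemma LongPath.le_card {F : Finset V} {x y : V} {m : ℕ} (h : LongPath G F x y m) :
    m ≤ Fintype.card V := by
  obtain ⟨l, -, h2, -, h4⟩ := h
  exact h4.trans h2.length_le_card

lemma Triple.le_card {C H : Finset V} {m : ℕ} (h : Triple G C H m) : m ≤ Fintype.card V := by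
  obtain ⟨x₁, -, x₂, -, x₃, -, -, -, -, ⟨u, w, -, -, h⟩, -⟩ := h
  exact h.le_card

lemma exists_maximal_nat {P : ℕ → Prop} {n b : ℕ} (hn : P n) (hb : ∀ k, P k → k ≤ b) :
    ∃ m, P m ∧ n ≤ m ∧ ∀ k, P k → k ≤ m := by
  classical
  exact ⟨Nat.findGreatest P b, Nat.findGreatest_spec (hb n hn) hn, Nat.le_findGreatest (hb n hn) hn,
    fun k hk => Nat.le_findGreatest (hb k hk) hk⟩

lemma LongestCycle.three_mul_le [DecidableEq V] [DecidableRel G.Adj] {l : List V}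
    (hl : LongestCycle G l) {C : Finset V} (hlC : ∀ v, v ∈ C ↔ v ∈ l) (hG : ThreeConn G)
    (hC : 3 ≤ C.card) {z : V} (hz : z ∉ C) {s : ℕ}
    (hs : ∀ u v : V, u ≠ v → ¬ G.Adj u v →
      s ≤ (G.neighborFinset u ∪ G.neighborFinset v).card) : 3 * s ≤ 2 * l.length := by
  obtain ⟨H₀, hH₀, -⟩ := exists_isComp (G := G) hz
  obtain ⟨m, ⟨H, hH, hT⟩, hm1, hmax⟩ :=
    exists_maximal_nat (P := fun m => ∃ H, IsComp G C H ∧ Triple G C H m) (n := 1)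
      ⟨H₀, hH₀, hH₀.triple_one hG hC⟩ (fun k ⟨_, _, h⟩ => h.le_card)
  have hmax' : ∀ K k, IsComp G C K → Triple G C K k → k ≤ m := fun K k hK h => hmax k ⟨K, hK, h⟩
  obtain ⟨d, rfl⟩ : ∃ d, m = d + 1 := ⟨m - 1, by omega⟩
  by_cases hsp : 1 ≤ d ∨ ∀ K, IsComp G C K → ¬ IsSpecial G C K
  · refine hl.three_mul_le_of_triple hlC hG hC hH hT hmax' (fun K hK hKs _ => ?_) hs
    rcases hsp with h | h
    · exact h
    · exact absurd hKs (h K hK)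
  · push Not at hsp
    obtain ⟨hd, K, hK, hKs⟩ := hsp
    obtain rfl : d = 0 := by omega
    by_cases h2 : ∃ K', IsComp G C K' ∧ IsSpecial G C K' ∧ K' ≠ K
    · obtain ⟨K', hK', hKs', hne⟩ := h2
      exact hl.three_mul_le_of_special hlC hG hC hK' hK hne hKs' hKs hs
    · push Not at h2
      exact hl.three_mul_le_of_triple hlC hG hC hK (hK.triple_one hG hC) hmax'
        (fun K' hK' hKs' hne => absurd (h2 K' hK' hKs') hne) hs

lemma IsKConnected.threeConn [DecidableEq V] (h : IsKConnected 3 G) : ThreeConn G := by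
  rintro X S hS ⟨v, hvX, hvS⟩ ⟨z, hzX, hzS⟩
  by_contra hn
  push Not at hn
  obtain ⟨p⟩ := (h.2 S (by omega)).preconnected ⟨v, by simpa using hvS⟩ ⟨z, by simpa using hzS⟩
  have key : ∀ {a b : ((S : Set V)ᶜ : Set V)}, (G.induce ((S : Set V)ᶜ)).Walk a b →
      a.1 ∈ X → b.1 ∈ X := by
    intro a b p
    induction p with
    | nil => exact id
    | @cons a b c hab _ ih =>
      intro ha
      apply ih
      by_contra hb
      exact hn a.1 ha b.1 a.2 hb b.2 hab
  exact hzX (key p hvX)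

lemma ThreeConn.exists_lCycle [DecidableEq V] (hG : ThreeConn G) (hV : 3 < Fintype.card V) :
    ∃ l, LCycle G l ∧ 3 ≤ l.length := by
  have hout : ∀ S : Finset V, S.card ≤ 2 → ∃ z, z ∉ S := by
    intro S hS
    obtain ⟨z, -, hz⟩ := Finset.exists_mem_notMem_of_card_lt_card (s := S) (t := Finset.univ)
      (by rw [Finset.card_univ]; omega)
    exact ⟨z, hz⟩
  obtain ⟨v, -⟩ := hout ∅ (by simp)
  obtain ⟨z, hz⟩ := hout {v} (by simp)
  obtain ⟨v', hv', w, -, hwv, -, hvw⟩ := hG {v} ∅ (by simp) ⟨v, by simp⟩ ⟨z, hz, by simp⟩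
  rw [Finset.mem_singleton] at hv' hwv
  subst hv'
  obtain ⟨z, hz⟩ := hout {v', w} Finset.card_le_two
  rw [Finset.mem_insert, Finset.mem_singleton, not_or] at hz
  obtain ⟨v, hv, w', -, hwv', hww', hvw'⟩ := hG {v'} {w} (by simp)
    ⟨v', by simp, by simpa using Ne.symm hwv⟩ ⟨z, by simpa using hz.1, by simpa using hz.2⟩
  rw [Finset.mem_singleton] at hv hwv' hww'
  subst hv
  have hp : LongPath G (Finset.univ.erase v) w w' 1 := by
    refine longPath_of_bd (by simpa using hwv) fun X hX hw hw' => ?_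
    have hvX : v ∉ X := fun h => by simpa using hX h
    obtain ⟨a, ha, b, -, h2, h3, h4⟩ := hG X {v} (by simp) ⟨w, hw, by simpa using hwv⟩
      ⟨w', hw', by simpa using hwv'⟩
    exact ⟨b, mem_bd.2 ⟨by simpa using h3, h2, a, ha, h4⟩⟩
  obtain ⟨l, h1, h2, h3, h4⟩ := hp.two_le (Ne.symm hww')
  refine ⟨v :: l, ⟨?_, v, w', h1.cons hvw, hvw'.symm⟩, by simpa using h4⟩
  exact List.nodup_cons.2 ⟨fun h => by simpa using h3 v h, h2⟩

lemma le_circumference {m : ℕ} (h : HasCycleLength G m) : m ≤ circumference G := by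
  refine le_csSup ⟨Fintype.card V, ?_⟩ h
  rintro k ⟨v, p, hp, rfl⟩
  have := hp.support_nodup.length_le_card
  simpa using this

end Selection

theorem stmt_5 {V : Type*} [Fintype V] [DecidableEq V] (G : SimpleGraph V) [DecidableRel G.Adj]
    (s : ℕ) (h3 : IsKConnected 3 G)
    (hs : ∀ u v : V, u ≠ v → ¬ G.Adj u v →
      s ≤ (G.neighborFinset u ∪ G.neighborFinset v).card) :
    min (Fintype.card V : ℝ) (3 * s / 2) ≤ (circumference G : ℝ) := by
  have hG := h3.threeConn
  obtain ⟨l₀, hl₀, hlen₀⟩ := hG.exists_lCycle h3.1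
  obtain ⟨m, ⟨l, hl, rfl⟩, hlen, hmax⟩ :=
    exists_maximal_nat (P := fun m => ∃ l, LCycle G l ∧ l.length = m) ⟨l₀, hl₀, rfl⟩
      (fun k ⟨_, h, e⟩ => e ▸ h.1.length_le_card)
  have hL : LongestCycle G l := ⟨hl, fun l' h => hmax _ ⟨l', h, rfl⟩⟩
  have hcirc : (l.length : ℝ) ≤ circumference G := by
    exact_mod_cast le_circumference (hl.hasCycleLength (hlen₀.trans hlen))
  have hcard := List.toFinset_card_of_nodup hl.1
  refine le_trans ?_ hcirc
  by_cases hz : ∃ z, z ∉ l.toFinset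
  · obtain ⟨z, hz⟩ := hz
    have : 3 * s ≤ 2 * l.length :=
      hL.three_mul_le (fun v => List.mem_toFinset) hG (by omega) hz hs
    have : (3 * s : ℝ) ≤ 2 * l.length := by exact_mod_cast this
    exact (min_le_right _ _).trans (by linarith)
  · push Not at hz
    have : l.toFinset = Finset.univ := Finset.eq_univ_iff_forall.2 hz
    rw [this, Finset.card_univ] at hcard
    rw [hcard]
    exact min_le_left _ _
end

section
/- If a graph G on n vertices has minimum degree δ(G) ≥ n/2, then G is pancyclic, unless n = 2r and G is isomorphic to the complete bipartite graph K_{r,r}. -/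
open SimpleGraph

/-- The first `k` terms of `p` are the successive vertices of a path of `G`. -/
structure IsPathSeq {V : Type*} (G : SimpleGraph V) (k : ℕ) (p : ℕ → V) : Prop where
  adj : ∀ i, i + 1 < k → G.Adj (p i) (p (i + 1))
  ne : ∀ i j, i < j → j < k → p i ≠ p j

/-- The sequence `f` runs periodically around a cycle of `G` with `N` vertices. -/
structure IsCyclicSeq {V : Type*} (G : SimpleGraph V) (N : ℕ) (f : ℕ → V) : Prop where
  adj : ∀ i, G.Adj (f i) (f (i + 1))
  periodic : ∀ i, f (i + N) = f i
  ne : ∀ i j, i < j → j < i + N → f i ≠ f j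

section Sequences

variable {V : Type*} {G : SimpleGraph V} {k N : ℕ} {p f : ℕ → V}

lemma IsPathSeq.injOn (h : IsPathSeq G k p) : Set.InjOn p (Finset.range k) := by
  intro i hi j hj hij
  simp only [Finset.coe_range, Set.mem_Iio] at hi hj
  rcases lt_trichotomy i j with hlt | rfl | hlt
  · exact absurd hij (h.ne i j hlt hj)
  · rfl
  · exact absurd hij.symm (h.ne j i hlt hi)

lemma IsPathSeq.card_image [DecidableEq V] (h : IsPathSeq G k p) :
    ((Finset.range k).image p).card = k := by
  rw [Finset.card_image_of_injOn h.injOn, Finset.card_range]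

lemma IsPathSeq.le_card [Fintype V] (h : IsPathSeq G k p) : k ≤ Fintype.card V := by
  classical
  rw [← h.card_image]
  exact Finset.card_le_univ _

lemma IsPathSeq.exists_eq_of_card [Fintype V] (h : IsPathSeq G k p)
    (hk : k = Fintype.card V) (v : V) : ∃ i < k, p i = v := by
  classical
  have hu := Finset.eq_univ_of_card ((Finset.range k).image p) (h.card_image.trans hk)
  have hv : v ∈ (Finset.range k).image p := hu ▸ Finset.mem_univ v
  simpa using hv

lemma IsPathSeq.exists_notMem [Fintype V] (h : IsPathSeq G k p)
    (hk : k < Fintype.card V) : ∃ v, ∀ i < k, p i ≠ v := by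
  classical
  by_contra! hc
  have hu : (Finset.range k).image p = Finset.univ := by
    ext v
    simpa using hc v
  have := h.card_image
  rw [hu, Finset.card_univ] at this
  omega

lemma IsPathSeq.cons (h : IsPathSeq G k p) {w : V} (hw : ∀ i < k, p i ≠ w)
    (hadj : G.Adj w (p 0)) : IsPathSeq G (k + 1) (fun i => if i = 0 then w else p (i - 1)) := by
  constructor
  · intro i hi
    rcases i with _ | i
    · simpa using hadj
    · simpa using h.adj i (by omega)
  · intro i j hij hj
    obtain ⟨j, rfl⟩ : ∃ m, j = m + 1 := ⟨j - 1, by omega⟩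
    rcases i with _ | i
    · simpa using (hw j (by omega)).symm
    · simpa using h.ne i j (by omega) (by omega)

lemma IsPathSeq.reverse (h : IsPathSeq G k p) : IsPathSeq G k (fun i => p (k - 1 - i)) := by
  constructor
  · intro i hi
    have := h.adj (k - 1 - (i + 1)) (by omega)
    rw [show k - 1 - (i + 1) + 1 = k - 1 - i by omega] at this
    exact this.symm
  · intro i j hij hj
    exact (h.ne (k - 1 - j) (k - 1 - i) (by omega) (by omega)).symm

lemma IsPathSeq.isCyclicSeq (h : IsPathSeq G k p) (hk : 0 < k) (hc : G.Adj (p (k - 1)) (p 0)) :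
    IsCyclicSeq G k (fun i => p (i % k)) := by
  refine ⟨fun i => ?_, fun i => by simp, fun i j hij hj heq => ?_⟩
  · have hlt := Nat.mod_lt i hk
    by_cases hi : i % k + 1 < k
    · have h1 : (i + 1) % k = i % k + 1 := by
        rw [← Nat.mod_add_mod, Nat.mod_eq_of_lt hi]
      simpa only [h1] using h.adj _ hi
    · have h1 : (i + 1) % k = 0 := by
        rw [← Nat.mod_add_mod, show i % k + 1 = k by omega, Nat.mod_self]
      have h2 : i % k = k - 1 := by omega
      simpa only [h1, h2] using hc
  · have hmod : i % k = j % k := h.injOn (by simpa using Nat.mod_lt i hk)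
      (by simpa using Nat.mod_lt j hk) heq
    have hdvd : k ∣ j - i := (Nat.modEq_iff_dvd' hij.le).1 hmod
    have := Nat.le_of_dvd (by omega) hdvd
    omega

lemma IsPathSeq.hasCycleLength (h : IsPathSeq G k p) (hk : 3 ≤ k)
    (hc : G.Adj (p (k - 1)) (p 0)) : HasCycleLength G k := by
  set l := (List.range k).map p with hl
  have hne : l ≠ [] := by simp [hl]; omega
  have hchain : l.IsChain G.Adj := by
    rw [hl, List.isChain_map, List.isChain_range]
    exact fun m hm => h.adj m (by omega)
  have hnd : l.Nodup := List.Nodup.map_on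
    (fun x hx y hy hxy => h.injOn (by simpa using hx) (by simpa using hy) hxy) List.nodup_range
  let q := Walk.ofSupport l hne hchain
  have hq : q.IsPath := by
    rw [Walk.isPath_def, Walk.support_ofSupport]
    exact hnd
  have hlen : q.length = k - 1 := by simp [q, hl]
  have hadj : G.Adj (l.getLast hne) (l.head hne) := by
    simpa [hl, List.getLast_eq_getElem, List.head_eq_getElem] using hc
  refine ⟨_, Walk.cons hadj q, (Walk.cons_isCycle_iff _ _).2 ⟨hq, fun hmem => ?_⟩, ?_⟩
  · rw [Sym2.eq_swap] at hmem
    have := hq.length_eq_one_of_mem_edges hmem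
    omega
  · rw [Walk.length_cons, hlen]
    omega

lemma IsCyclicSeq.shift (h : IsCyclicSeq G N f) (s : ℕ) : IsCyclicSeq G N (fun i => f (s + i)) :=
  ⟨fun i => h.adj (s + i), fun i => by rw [← add_assoc, h.periodic],
    fun i j hij hj => h.ne (s + i) (s + j) (by omega) (by omega)⟩

lemma IsCyclicSeq.isPathSeq (h : IsCyclicSeq G N f) : IsPathSeq G N f :=
  ⟨fun i _ => h.adj i, fun i j hij hj => h.ne i j hij (by omega)⟩

lemma IsCyclicSeq.apply_mod (h : IsCyclicSeq G N f) (i : ℕ) : f (i % N) = f i :=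
  Function.Periodic.map_mod_nat h.periodic i

lemma degree_le_card_filter [Fintype V] [DecidableRel G.Adj] {v : V} {S : Finset ℕ}
    (h : ∀ w, G.Adj v w → ∃ i ∈ S, f i = w) :
    G.degree v ≤ (S.filter fun i => G.Adj v (f i)).card := by
  classical
  rw [← card_neighborFinset_eq_degree]
  refine (Finset.card_le_card fun w hw => ?_).trans (Finset.card_image_le (f := f))
  rw [mem_neighborFinset] at hw
  obtain ⟨i, hi, rfl⟩ := h w hw
  exact Finset.mem_image_of_mem _ (Finset.mem_filter.2 ⟨hi, hw⟩)

lemma exists_mem_inter_of_card_lt {S A B : Finset ℕ} (hA : A ⊆ S) (hB : B ⊆ S)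
    (h : S.card < A.card + B.card) : ∃ i, i ∈ A ∧ i ∈ B := by
  obtain ⟨i, hi⟩ := Finset.inter_nonempty_of_card_lt_card_add_card hA hB h
  exact ⟨i, Finset.mem_inter.1 hi⟩

/-- Joining the two ends of a path through a crossing pair of chords closes it to a cycle. -/
lemma IsPathSeq.exists_isCyclicSeq (h : IsPathSeq G k p) {i : ℕ} (hi : i + 1 < k)
    (h₀ : G.Adj (p 0) (p (i + 1))) (h₁ : G.Adj (p (k - 1)) (p i)) :
    ∃ f, IsCyclicSeq G k f := by
  refine ⟨_, IsPathSeq.isCyclicSeq (p := fun m => if m ≤ i then p m else p (k + i - m))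
    ⟨fun m hm => ?_, fun a b hab hb => ?_⟩ (by omega) ?_⟩
  · rcases lt_trichotomy m i with hlt | rfl | hlt
    · simpa [hlt.le, Nat.succ_le_of_lt hlt] using h.adj m hm
    · simpa [show k + m - (m + 1) = k - 1 by omega] using h₁.symm
    · have := h.adj (k + i - (m + 1)) (by omega)
      rw [show k + i - (m + 1) + 1 = k + i - m by omega] at this
      simpa [show ¬ m ≤ i by omega, show ¬ m + 1 ≤ i by omega] using this.symm
  · by_cases ha : a ≤ i <;> by_cases hb' : b ≤ i
    · simpa [ha, hb'] using h.ne a b hab hb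
    · simpa [ha, hb'] using h.ne a (k + i - b) (by omega) (by omega)
    · omega
    · simpa [ha, hb'] using (h.ne (k + i - b) (k + i - a) (by omega) (by omega)).symm
  · simpa [show ¬ k - 1 ≤ i by omega, show k + i - (k - 1) = i + 1 by omega] using h₀.symm

/-- A pair of chords leaving consecutive vertices of a cycle shortens it by one vertex. -/
lemma IsCyclicSeq.exists_pred_of_chords {n : ℕ} {f : ℕ → V} (hf : IsCyclicSeq G n f) {k : ℕ}
    (hk : 1 ≤ k) (hkn : k + 3 ≤ n) (h₀ : G.Adj (f 0) (f k)) (h₁ : G.Adj (f 1) (f (k + 2))) :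
    ∃ g, IsCyclicSeq G (n - 1) g := by
  refine ⟨_, IsPathSeq.isCyclicSeq (p := fun m => if m < k then f (m + 1) else f (n + k - m))
    ⟨fun m hm => ?_, fun a b hab hb => ?_⟩ (by omega) ?_⟩
  · rcases lt_trichotomy (m + 1) k with hlt | rfl | hlt
    · simpa [hlt, show m < k by omega] using hf.adj (m + 1)
    · have := hf.periodic 0
      rw [zero_add] at this
      simpa [this] using h₀.symm
    · have := hf.adj (n + k - (m + 1))
      rw [show n + k - (m + 1) + 1 = n + k - m by omega] at this
      simpa [show ¬ m < k by omega, show ¬ m + 1 < k by omega] using this.symm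
  · by_cases ha : a < k <;> by_cases hb' : b < k
    · simpa [ha, hb'] using hf.ne (a + 1) (b + 1) (by omega) (by omega)
    · simpa [ha, hb'] using hf.ne (a + 1) (n + k - b) (by omega) (by omega)
    · omega
    · simpa [ha, hb'] using (hf.ne (n + k - b) (n + k - a) (by omega) (by omega)).symm
  · simpa [show ¬ n - 1 - 1 < k by omega, show n + k - (n - 1 - 1) = k + 2 by omega,
      show 0 < k by omega]
      using h₁.symm

/-- A chord skipping one vertex of a cycle shortens it by one vertex. -/
lemma IsCyclicSeq.exists_pred_of_chord_two {n : ℕ} {f : ℕ → V} (hf : IsCyclicSeq G n f)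
    (hn : 3 ≤ n) (h : G.Adj (f 0) (f 2)) : ∃ g, IsCyclicSeq G (n - 1) g := by
  refine ⟨_, IsPathSeq.isCyclicSeq (p := fun m => f (m + 2))
    ⟨fun m _ => hf.adj (m + 2), fun a b hab hb => hf.ne _ _ (by omega) (by omega)⟩
    (by omega) ?_⟩
  have := hf.periodic 0
  rw [zero_add] at this
  simpa [show n - 1 - 1 + 2 = n by omega, this] using h

end Sequences

section Dirac

variable {V : Type*} [Fintype V] {G : SimpleGraph V} [DecidableRel G.Adj]

lemma exists_maximal_isPathSeq [Nonempty V] (G : SimpleGraph V) :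
    ∃ k p, IsPathSeq G k p ∧ ∀ q, ¬ IsPathSeq G (k + 1) q := by
  by_contra! hc
  have hall : ∀ k, ∃ p, IsPathSeq G k p := by
    intro k
    induction k with
    | zero => exact ⟨fun _ => Classical.arbitrary V, fun i hi => by omega, fun i j _ hj => by omega⟩
    | succ k ih => exact ih.elim (hc k)
  obtain ⟨p, hp⟩ := hall (Fintype.card V + 1)
  have := hp.le_card
  omega

/-- The theorem of Dirac: minimum degree at least `n / 2` forces a Hamiltonian cycle. -/
lemma exists_isCyclicSeq_card (hn : 3 ≤ Fintype.card V)
    (hδ : ∀ v, Fintype.card V ≤ 2 * G.degree v) :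
    ∃ f, IsCyclicSeq G (Fintype.card V) f := by
  classical
  have : Nonempty V := Fintype.card_pos_iff.1 (by omega)
  obtain ⟨k, p, hp, hmax⟩ := exists_maximal_isPathSeq G
  have hk : 0 < k := by
    by_contra h0
    exact hmax (fun _ => Classical.arbitrary V) ⟨fun i hi => by omega, fun i j _ hj => by omega⟩
  have hkn := hp.le_card
  have hstart : ∀ {q : ℕ → V}, IsPathSeq G k q → ∀ w, G.Adj (q 0) w → ∃ i < k, q i = w := by
    intro q hq w hw
    by_contra! hc
    exact hmax _ (hq.cons hc hw.symm)
  have hA : G.degree (p 0) ≤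
      ((Finset.range (k - 1)).filter fun i => G.Adj (p 0) (p (i + 1))).card := by
    refine degree_le_card_filter (f := fun i => p (i + 1)) fun w hw => ?_
    obtain ⟨i, hi, rfl⟩ := hstart hp w hw
    have : i ≠ 0 := by rintro rfl; exact hw.ne rfl
    exact ⟨i - 1, by simp; omega, by simp [show i - 1 + 1 = i by omega]⟩
  have hB : G.degree (p (k - 1)) ≤
      ((Finset.range (k - 1)).filter fun i => G.Adj (p (k - 1)) (p i)).card := by
    refine degree_le_card_filter fun w hw => ?_
    obtain ⟨i, hi, rfl⟩ := hstart hp.reverse w (by simpa using hw)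
    have : i ≠ 0 := by rintro rfl; exact hw.ne (by simp)
    exact ⟨k - 1 - i, by simp; omega, rfl⟩
  have h0 := hδ (p 0)
  have h1 := hδ (p (k - 1))
  have hdeg : Fintype.card V ≤ 2 * (k - 1) := by
    have := hA.trans (Finset.card_filter_le _ _)
    rw [Finset.card_range] at this
    omega
  obtain ⟨i, hiA, hiB⟩ := exists_mem_inter_of_card_lt (S := Finset.range (k - 1))
    (Finset.filter_subset (fun i => G.Adj (p 0) (p (i + 1))) _)
    (Finset.filter_subset (fun i => G.Adj (p (k - 1)) (p i)) _)
    (by rw [Finset.card_range]; omega)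
  simp only [Finset.mem_filter, Finset.mem_range] at hiA hiB
  obtain ⟨f, hf⟩ := hp.exists_isCyclicSeq (by omega) hiA.2 hiB.2
  rcases hkn.eq_or_lt with rfl | hlt
  · exact ⟨f, hf⟩
  exfalso
  obtain ⟨w, hw⟩ := hf.isPathSeq.exists_notMem hlt
  obtain ⟨i, hi⟩ : ∃ i, G.Adj w (f i) := by
    by_contra! hc
    have hdisj : Disjoint (insert w (G.neighborFinset w)) ((Finset.range k).image f) := by
      rw [Finset.disjoint_right]
      intro v hv
      simp only [Finset.mem_image, Finset.mem_range] at hv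
      obtain ⟨i, hi, rfl⟩ := hv
      simpa using ⟨hw i hi, hc i⟩
    have hcard := Finset.card_le_univ (insert w (G.neighborFinset w) ∪ (Finset.range k).image f)
    rw [Finset.card_union_of_disjoint hdisj, hf.isPathSeq.card_image,
      Finset.card_insert_of_notMem (by simp), card_neighborFinset_eq_degree] at hcard
    have := hδ w
    omega
  refine hmax _ ((hf.shift i).isPathSeq.cons (fun m _ => ?_) (by simpa using hi))
  rw [← hf.apply_mod]
  exact hw _ (Nat.mod_lt _ hk)

/-- A cycle missing exactly one vertex, under the degree condition, yields all cycle lengths. -/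
lemma hasCycleLength_of_isCyclicSeq {N : ℕ} {f : ℕ → V} (hN : N + 1 = Fintype.card V)
    (hf : IsCyclicSeq G N f) (hδ : ∀ v, Fintype.card V ≤ 2 * G.degree v) {l : ℕ}
    (hl : 3 ≤ l) (hln : l ≤ Fintype.card V) : HasCycleLength G l := by
  classical
  obtain ⟨w, hw⟩ := hf.isPathSeq.exists_notMem (by omega)
  have hNpos : 0 < N := by omega
  have hw' : ∀ i, f i ≠ w := fun i => by
    rw [← hf.apply_mod]
    exact hw _ (Nat.mod_lt _ hNpos)
  have hcover : ∀ v, v ≠ w → ∃ i ∈ Finset.range N, f i = v := by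
    have himg : (Finset.range N).image f = Finset.univ.erase w := by
      refine Finset.eq_of_subset_of_card_le (fun v hv => ?_) ?_
      · obtain ⟨i, -, rfl⟩ := Finset.mem_image.1 hv
        simpa using hw' i
      · rw [hf.isPathSeq.card_image, Finset.card_erase_of_mem (Finset.mem_univ w),
          Finset.card_univ]
        omega
    intro v hv
    have : v ∈ (Finset.range N).image f := by simp [himg, hv]
    simpa using this
  have hA : G.degree w ≤ ((Finset.range N).filter fun i => G.Adj w (f i)).card :=
    degree_le_card_filter fun v hv => hcover v hv.ne'
  have hB : G.degree w ≤ ((Finset.range N).filter fun i => G.Adj w (f (l - 2 + i))).card := by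
    refine degree_le_card_filter (f := fun i => f (l - 2 + i)) fun v hv => ?_
    obtain ⟨i, hi, rfl⟩ := hcover v hv.ne'
    refine ⟨(i + (N - (l - 2))) % N, by simpa using Nat.mod_lt _ hNpos, ?_⟩
    rw [← (hf.shift (l - 2)).apply_mod, Nat.mod_mod, (hf.shift (l - 2)).apply_mod,
      show l - 2 + (i + (N - (l - 2))) = i + N by omega, hf.periodic]
  have := hδ w
  obtain ⟨j, hjA, hjB⟩ := exists_mem_inter_of_card_lt
    (Finset.filter_subset (fun i => G.Adj w (f i)) (Finset.range N))
    (Finset.filter_subset (fun i => G.Adj w (f (l - 2 + i))) (Finset.range N))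
    (by rw [Finset.card_range]; omega)
  simp only [Finset.mem_filter] at hjA hjB
  have hpath : IsPathSeq G (l - 1) (fun i => f (j + i)) :=
    ⟨fun i _ => hf.adj (j + i), fun a b hab hb => hf.ne (j + a) (j + b) (by omega) (by omega)⟩
  have hcyc := hpath.cons (fun i _ => hw' (j + i)) (by simpa using hjA.2)
  rw [show l - 1 + 1 = l by omega] at hcyc
  refine hcyc.hasCycleLength hl ?_
  simpa [show l - 1 ≠ 0 by omega, show j + (l - 1 - 1) = l - 2 + j by omega] using hjB.2.symm

/-- If no cycle has `n - 1` vertices, chords from consecutive vertices of a Hamiltonian cycle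
exclude each other in complementary pairs. -/
lemma IsCyclicSeq.adj_iff_not_adj {n : ℕ} {f : ℕ → V} (hf : IsCyclicSeq G n f)
    (hn : n = Fintype.card V) (hn4 : 4 ≤ n) (hδ : ∀ v, Fintype.card V ≤ 2 * G.degree v)
    (hno : ¬ ∃ g, IsCyclicSeq G (n - 1) g) {k : ℕ} (hk : 2 ≤ k) (hkn : k + 3 ≤ n) :
    G.Adj (f 1) (f (k + 2)) ↔ ¬ G.Adj (f 0) (f k) := by
  classical
  refine ⟨fun h₁ h₀ => hno (hf.exists_pred_of_chords (by omega) hkn h₀ h₁), fun h₀ => ?_⟩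
  by_contra h₁
  have hn0 : f n = f 0 := by simpa using hf.periodic 0
  have hA : G.degree (f 0) ≤
      (({1, n - 1} ∪ (Finset.Icc 2 (n - 3)).filter fun i => G.Adj (f 0) (f i))).card := by
    refine (degree_le_card_filter (f := f)
      (S := {1, n - 1} ∪ (Finset.Icc 2 (n - 3)).filter fun i => G.Adj (f 0) (f i))
      fun w hw => ?_).trans (Finset.card_filter_le _ _)
    obtain ⟨i, hi, rfl⟩ := hf.isPathSeq.exists_eq_of_card hn w
    refine ⟨i, ?_, rfl⟩
    have hi0 : i ≠ 0 := by rintro rfl; exact hw.ne rfl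
    have hi2 : i ≠ n - 2 := by
      rintro rfl
      refine hno ((hf.shift (n - 2)).exists_pred_of_chord_two (by omega) ?_)
      simpa [show n - 2 + 2 = n by omega, hn0] using hw.symm
    simp only [Finset.mem_union, Finset.mem_insert, Finset.mem_singleton, Finset.mem_filter,
      Finset.mem_Icc]
    by_cases h1 : i = 1 ∨ i = n - 1
    · exact Or.inl h1
    · exact Or.inr ⟨by omega, hw⟩
  have hB : G.degree (f 1) ≤
      (({0, n - 2} ∪ (Finset.Icc 2 (n - 3)).filter fun i => G.Adj (f 1) (f (i + 2)))).card := by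
    refine (degree_le_card_filter (f := fun i => f (i + 2))
      (S := {0, n - 2} ∪ (Finset.Icc 2 (n - 3)).filter fun i => G.Adj (f 1) (f (i + 2)))
      fun w hw => ?_).trans (Finset.card_filter_le _ _)
    obtain ⟨i, hi, rfl⟩ := hf.isPathSeq.exists_eq_of_card hn w
    have hi1 : i ≠ 1 := by rintro rfl; exact hw.ne rfl
    have hi3 : i ≠ 3 := by
      rintro rfl
      exact hno ((hf.shift 1).exists_pred_of_chord_two (by omega) hw)
    rcases Nat.eq_zero_or_pos i with rfl | hpos
    · exact ⟨n - 2, by simp, by simp [show n - 2 + 2 = n by omega, hn0]⟩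
    · have h2 : i - 2 + 2 = i := by omega
      refine ⟨i - 2, ?_, by simp [h2]⟩
      simp only [Finset.mem_union, Finset.mem_insert, Finset.mem_singleton, Finset.mem_filter,
        Finset.mem_Icc, h2]
      by_cases h1 : i = 2
      · exact Or.inl (Or.inl (by omega))
      · exact Or.inr ⟨by omega, hw⟩
  have hA' := hA.trans (Finset.card_union_le _ _)
  have hB' := hB.trans (Finset.card_union_le _ _)
  rw [Finset.card_pair (by omega)] at hA' hB'
  have hsum := hδ (f 0)
  have hsum' := hδ (f 1)
  obtain ⟨i, hiA, hiB⟩ := exists_mem_inter_of_card_lt (S := (Finset.Icc 2 (n - 3)).erase k)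
    (A := (Finset.Icc 2 (n - 3)).filter fun i => G.Adj (f 0) (f i))
    (B := (Finset.Icc 2 (n - 3)).filter fun i => G.Adj (f 1) (f (i + 2)))
    (by intro i hi; simp only [Finset.mem_filter] at hi
        exact Finset.mem_erase.2 ⟨by rintro rfl; exact h₀ hi.2, hi.1⟩)
    (by intro i hi; simp only [Finset.mem_filter] at hi
        exact Finset.mem_erase.2 ⟨by rintro rfl; exact h₁ hi.2, hi.1⟩)
    (by rw [Finset.card_erase_of_mem (by simp; omega), Nat.card_Icc]; omega)
  simp only [Finset.mem_filter, Finset.mem_Icc] at hiA hiB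
  exact hno (hf.exists_pred_of_chords (by omega) (by omega) hiA.2 hiB.2)

/-- If no cycle has `n - 1` vertices, the chords of a Hamiltonian cycle are those of odd span. -/
lemma IsCyclicSeq.adj_iff_odd {n : ℕ} (hn : n = Fintype.card V) (hn4 : 4 ≤ n)
    (hδ : ∀ v, Fintype.card V ≤ 2 * G.degree v) (hno : ¬ ∃ g, IsCyclicSeq G (n - 1) g)
    {k : ℕ} (hk : 1 ≤ k) (hkn : k + 2 ≤ n) :
    ∀ {f : ℕ → V}, IsCyclicSeq G n f → (G.Adj (f 0) (f k) ↔ Odd k) := by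
  induction k, hk using Nat.le_induction with
  | base => exact fun hf => by simpa using hf.adj 0
  | succ k hk ih =>
    intro f hf
    obtain rfl | hk2 : k = 1 ∨ 2 ≤ k := by omega
    · exact iff_of_false (fun h => hno (hf.exists_pred_of_chord_two (by omega) h)) (by decide)
    · have hg := hf.shift (n - 1)
      have h := hg.adj_iff_not_adj hn hn4 hδ hno hk2 (by omega)
      rw [ih (by omega) hg] at h
      have h1 : n - 1 + 1 = 0 + n := by omega
      have h2 : n - 1 + (k + 2) = k + 1 + n := by omega
      simp only [h1, h2, hf.periodic] at h
      rw [h, Nat.odd_add_one]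

end Dirac

/-- A Hamiltonian graph whose cycle has exactly its odd-span chords is complete bipartite. -/
lemma IsCyclicSeq.nonempty_iso {V : Type*} [Fintype V] {G : SimpleGraph V} {r : ℕ} {f : ℕ → V}
    (hf : IsCyclicSeq G (2 * r) f) (hr : Fintype.card V = 2 * r)
    (hadj : ∀ i j, i < j → j < 2 * r → (G.Adj (f i) (f j) ↔ Odd (j - i))) :
    Nonempty (G ≃g completeBipartiteGraph (Fin r) (Fin r)) := by
  let pos : Fin r ⊕ Fin r → ℕ := Sum.elim (fun i => 2 * i) (fun i => 2 * i + 1)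
  have hpos : ∀ x, pos x < 2 * r := by rintro (i | i) <;> grind
  have hinj : Function.Injective (fun x => f (pos x)) := by
    intro x y hxy
    have := hf.isPathSeq.injOn (by simpa using hpos x) (by simpa using hpos y) hxy
    rcases x with i | i <;> rcases y with j | j <;> simp [pos] at this ⊢ <;> omega
  have hbij : Function.Bijective (fun x => f (pos x)) :=
    (Fintype.bijective_iff_injective_and_card _).2 ⟨hinj, by simp [hr, two_mul]⟩
  have hodd : ∀ i j, i < 2 * r → j < 2 * r → (G.Adj (f i) (f j) ↔ Odd (i + j)) := by
    intro i j hi hj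
    rcases lt_trichotomy i j with hlt | rfl | hlt
    · rw [hadj i j hlt hj, Nat.odd_sub hlt.le, Nat.odd_add]
      grind
    · simp
    · rw [G.adj_comm, hadj j i hlt hi, Nat.odd_sub hlt.le, Nat.odd_add]
  refine ⟨RelIso.symm ⟨Equiv.ofBijective _ hbij, ?_⟩⟩
  intro x y
  rw [Equiv.ofBijective_apply, Equiv.ofBijective_apply, hodd _ _ (hpos x) (hpos y)]
  rcases x with i | i <;> rcases y with j | j <;> simp [pos] <;> grind

theorem stmt_7 {V : Type*} [Fintype V] (G : SimpleGraph V) [DecidableRel G.Adj]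
    (hδ : ∀ v, (Fintype.card V : ℝ) / 2 ≤ (G.degree v : ℝ)) :
    (∀ l, 3 ≤ l → l ≤ Fintype.card V → HasCycleLength G l) ∨
      ∃ r, Fintype.card V = 2 * r ∧
        Nonempty (G ≃g completeBipartiteGraph (Fin r) (Fin r)) := by
  have hδ' : ∀ v, Fintype.card V ≤ 2 * G.degree v := by
    intro v
    have := hδ v
    have : (Fintype.card V : ℝ) ≤ 2 * G.degree v := by linarith
    exact_mod_cast this
  obtain hlt | hn3 := Nat.lt_or_ge (Fintype.card V) 3
  · exact Or.inl fun l hl hln => by omega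
  obtain ⟨f, hf⟩ := exists_isCyclicSeq_card hn3 hδ'
  by_cases hpred : ∃ g, IsCyclicSeq G (Fintype.card V - 1) g
  · obtain ⟨g, hg⟩ := hpred
    exact Or.inl fun l hl hln => hasCycleLength_of_isCyclicSeq (by omega) hg hδ' hl hln
  have hn0 : f (Fintype.card V) = f 0 := by simpa using hf.periodic 0
  obtain hn4 | hn4 : Fintype.card V = 3 ∨ 4 ≤ Fintype.card V := by omega
  · refine Or.inl fun l hl hln => ?_
    obtain rfl : l = Fintype.card V := by omega
    refine hf.isPathSeq.hasCycleLength hl ?_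
    rw [← hn0]
    have := hf.adj (Fintype.card V - 1)
    rwa [show Fintype.card V - 1 + 1 = Fintype.card V by omega] at this
  right
  have heven : ¬ Odd (Fintype.card V - 2) := by
    rw [← hf.adj_iff_odd rfl hn4 hδ' hpred (by omega) (by omega)]
    intro h
    refine hpred ((hf.shift (Fintype.card V - 2)).exists_pred_of_chord_two hn3 ?_)
    simpa [show Fintype.card V - 2 + 2 = Fintype.card V by omega, hn0] using h.symm
  obtain ⟨r, hr⟩ : ∃ r, Fintype.card V = 2 * r := by
    obtain ⟨s, hs⟩ := Nat.not_odd_iff_even.1 heven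
    exact ⟨s + 1, by omega⟩
  refine ⟨r, hr, (hr ▸ hf).nonempty_iso hr fun i j hij hj => ?_⟩
  obtain hlast | hmid : j = i + (2 * r - 1) ∨ j - i + 2 ≤ Fintype.card V := by omega
  · obtain rfl : i = 0 := by omega
    have h1 : Odd (j - 0) := ⟨r - 1, by omega⟩
    have h2 := hf.adj j
    rw [show j + 1 = Fintype.card V by omega, hn0] at h2
    exact iff_of_true h2.symm h1
  · simpa [show i + (j - i) = j by omega] using
      (hf.shift i).adj_iff_odd rfl hn4 hδ' hpred (k := j - i) (by omega) hmid
end
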